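/- There exists ε > 0 with the following property. Let N ≥ 1 be an integer, let γ ∈ (1, 1+ε), and let U : ℝ → ℝ be an even, smooth, nonconstant, 2π-periodic solution of ((γ − U(z))·U'(z))' + U(z) = 0 with sup_{z∈ℝ} |U(z)| ≤ ε. For λ ∈ ℝ, let E_λ be the real vector space of smooth 2πN-periodic functions v : ℝ → ℝ with ∫₀^{2πN} v = 0 satisfying ((U(z) − γ − λ)·v(z))'' = v(z) for all z ∈ ℝ. Then: (i) the set of λ > 0 with E_λ ≠ {0} is finite, and the sum of dim E_λ over these λ equals 2N − 1; (ii) E₀ is one-dimensional and is spanned by U'. -/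

import Mathlib

open Real

/-- The eigenspace `E_λ`: smooth `2πN`-periodic zero-mean solutions `v` of
`((U − γ − λ)·v)'' = v`, the twice-differentiated form of `L_γ v = λ v`. -/
def EigSetL (U : ℝ → ℝ) (γ lam : ℝ) (N : ℕ) : Set (ℝ → ℝ) :=
  {v | ContDiff ℝ (⊤ : ℕ∞) v ∧ Function.Periodic v (2 * π * N) ∧
    (∫ z in (0:ℝ)..(2 * π * N), v z) = 0 ∧
    ∀ z : ℝ, iteratedDeriv 2 (fun w => (U w - γ - lam) * v w) z = v z}

/-- The terms of the Peano–Baker series of the linear equation `X' = A X`, `X 0 = x₀`. -/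
noncomputable def peanoBakerTerm {E : Type*} [NormedAddCommGroup E] [NormedSpace ℝ E]
    (A : ℝ → E →L[ℝ] E) (x₀ : E) : ℕ → ℝ → E
  | 0 => fun _ => x₀
  | n + 1 => fun z => ∫ t in (0:ℝ)..z, A t (peanoBakerTerm A x₀ n t)

section PeanoBaker

variable {E : Type*} [NormedAddCommGroup E] [NormedSpace ℝ E]

theorem continuous_peanoBakerTerm {A : ℝ → E →L[ℝ] E} (hA : Continuous A) (x₀ : E) (n : ℕ) :
    Continuous (peanoBakerTerm A x₀ n) := by
  induction n with
  | zero => exact continuous_const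
  | succ n ih =>
    have hc : Continuous fun t => A t (peanoBakerTerm A x₀ n t) := hA.clm_apply ih
    exact intervalIntegral.continuous_primitive (fun a b => hc.intervalIntegrable a b) 0

theorem hasDerivAt_peanoBakerTerm_succ [CompleteSpace E] {A : ℝ → E →L[ℝ] E}
    (hA : Continuous A) (x₀ : E) (n : ℕ) (z : ℝ) :
    HasDerivAt (peanoBakerTerm A x₀ (n + 1)) (A z (peanoBakerTerm A x₀ n z)) z := by
  have hc : Continuous fun t => A t (peanoBakerTerm A x₀ n t) :=
    hA.clm_apply (continuous_peanoBakerTerm hA x₀ n)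
  exact intervalIntegral.integral_hasDerivAt_right (hc.intervalIntegrable _ _)
    (hc.stronglyMeasurableAtFilter _ _) hc.continuousAt

theorem norm_peanoBakerTerm_le {A : ℝ → E →L[ℝ] E} (hA : Continuous A) {K : ℝ}
    (hK : ∀ t, ‖A t‖ ≤ K) (x₀ : E) (n : ℕ) (z : ℝ) :
    ‖peanoBakerTerm A x₀ n z‖ ≤ (K * |z|) ^ n / n.factorial * ‖x₀‖ := by
  have hK0 : 0 ≤ K := (norm_nonneg _).trans (hK 0)
  induction n generalizing z with
  | zero => simp [peanoBakerTerm]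
  | succ n ih =>
    calc ‖peanoBakerTerm A x₀ (n + 1) z‖
        ≤ ∫ t in Set.uIoc 0 z, ‖A t (peanoBakerTerm A x₀ n t)‖ :=
          intervalIntegral.norm_integral_le_integral_norm_uIoc
      _ ≤ ∫ t in Set.uIoc 0 z, K ^ (n + 1) / n.factorial * ‖x₀‖ * |t - 0| ^ n := by
          have hc : Continuous fun t => A t (peanoBakerTerm A x₀ n t) :=
            hA.clm_apply (continuous_peanoBakerTerm hA x₀ n)
          refine MeasureTheory.setIntegral_mono (hc.norm.integrableOn_uIoc)
            (Continuous.integrableOn_uIoc (by fun_prop)) fun t => ?_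
          calc ‖A t (peanoBakerTerm A x₀ n t)‖ ≤ ‖A t‖ * ‖peanoBakerTerm A x₀ n t‖ :=
                (A t).le_opNorm _
            _ ≤ K * ((K * |t|) ^ n / n.factorial * ‖x₀‖) :=
                mul_le_mul (hK t) (ih t) (norm_nonneg _) hK0
            _ = K ^ (n + 1) / n.factorial * ‖x₀‖ * |t - 0| ^ n := by
                rw [sub_zero, mul_pow]; ring
      _ = (K * |z|) ^ (n + 1) / (n + 1).factorial * ‖x₀‖ := by
          rw [MeasureTheory.integral_const_mul, integral_pow_abs_sub_uIoc, sub_zero, mul_pow,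
            Nat.factorial_succ]
          push_cast
          field_simp

/-- Global solvability of linear equations with bounded continuous coefficients. -/
theorem exists_forall_hasDerivAt_linear [CompleteSpace E] {A : ℝ → E →L[ℝ] E}
    (hA : Continuous A) {K : ℝ}
    (hK : ∀ t, ‖A t‖ ≤ K) (x₀ : E) :
    ∃ X : ℝ → E, X 0 = x₀ ∧ ∀ z, HasDerivAt X (A z (X z)) z := by
  have hK0 : 0 ≤ K := (norm_nonneg _).trans (hK 0)
  have hbound : ∀ (R : ℝ) (n : ℕ), ∀ y ∈ Set.Ioo (-R) R,
      ‖peanoBakerTerm A x₀ n y‖ ≤ (K * R) ^ n / n.factorial * ‖x₀‖ := fun R n y hy =>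
    (norm_peanoBakerTerm_le hA hK x₀ n y).trans (by
      have : |y| ≤ R := abs_le.2 ⟨hy.1.le, hy.2.le⟩
      gcongr)
  have hsumR : ∀ R : ℝ, Summable fun n : ℕ => (K * R) ^ n / n.factorial * ‖x₀‖ := fun R =>
    (Real.summable_pow_div_factorial _).mul_right _
  have hmem : ∀ z : ℝ, z ∈ Set.Ioo (-(|z| + 1)) (|z| + 1) := fun z =>
    abs_lt.1 (lt_add_one |z|)
  have hsum : ∀ z, Summable fun n => peanoBakerTerm A x₀ n z := fun z =>
    Summable.of_norm_bounded (hsumR (|z| + 1)) fun n => hbound _ n z (hmem z)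
  refine ⟨fun z => ∑' n, peanoBakerTerm A x₀ n z, ?_, fun z => ?_⟩
  · have h0 : ∀ n ≠ 0, peanoBakerTerm A x₀ n 0 = 0 := by
      intro n hn
      obtain ⟨m, rfl⟩ := Nat.exists_eq_succ_of_ne_zero hn
      simp [peanoBakerTerm]
    simp only [tsum_eq_single 0 h0]
    rfl
  · have hder := hasDerivAt_tsum_of_isPreconnected
      (u := fun n : ℕ => K * ((K * (|z| + 1)) ^ n / n.factorial * ‖x₀‖))
      (g := fun n => peanoBakerTerm A x₀ (n + 1))
      (g' := fun n y => A y (peanoBakerTerm A x₀ n y))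
      ((hsumR _).mul_left K) isOpen_Ioo isPreconnected_Ioo
      (fun n y _ => hasDerivAt_peanoBakerTerm_succ hA x₀ n y)
      (fun n y hy => ((A y).le_opNorm _).trans
        (mul_le_mul (hK y) (hbound _ n y hy) (norm_nonneg _) hK0))
      (hmem z) ((summable_nat_add_iff 1).2 (hsum z)) (hmem z)
    rw [← (A z).map_tsum (hsum z)] at hder
    have heq : (fun z => ∑' n, peanoBakerTerm A x₀ n z) =
        fun z => x₀ + ∑' n, peanoBakerTerm A x₀ (n + 1) z := by
      funext y
      rw [(hsum y).tsum_eq_zero_add]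
      rfl
    have := hder.const_add x₀
    rw [heq]
    convert this using 2
    rw [(hsum z).tsum_eq_zero_add]
    rfl

end PeanoBaker

/-- `w` solves `w'' + q w = 0` on the line, with first derivative `w'`. -/
def IsHillSol (q w w' : ℝ → ℝ) : Prop :=
  ∀ z, HasDerivAt w (w' z) z ∧ HasDerivAt w' (-(q z * w z)) z

theorem exists_isHillSol {q : ℝ → ℝ} (hq : Continuous q) {Q : ℝ} (hQ : ∀ z, |q z| ≤ Q)
    (α β : ℝ) : ∃ w w' : ℝ → ℝ, IsHillSol q w w' ∧ w 0 = α ∧ w' 0 = β := by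
  let fst := ContinuousLinearMap.fst ℝ ℝ ℝ
  let snd := ContinuousLinearMap.snd ℝ ℝ ℝ
  let A : ℝ → ℝ × ℝ →L[ℝ] ℝ × ℝ := fun t =>
    (ContinuousLinearMap.inl ℝ ℝ ℝ).comp snd -
      q t • (ContinuousLinearMap.inr ℝ ℝ ℝ).comp fst
  have hA : Continuous A := continuous_const.sub (hq.smul continuous_const)
  have hK : ∀ t, ‖A t‖ ≤ ‖(ContinuousLinearMap.inl ℝ ℝ ℝ).comp snd‖ +
      Q * ‖(ContinuousLinearMap.inr ℝ ℝ ℝ).comp fst‖ := by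
    intro t
    refine (norm_sub_le _ _).trans ?_
    rw [norm_smul]
    gcongr
    exact hQ t
  obtain ⟨X, hX0, hX⟩ := exists_forall_hasDerivAt_linear hA hK (α, β)
  refine ⟨fun z => (X z).1, fun z => (X z).2, fun z => ⟨?_, ?_⟩, by simp [hX0], by simp [hX0]⟩
  · refine (hasFDerivAt_fst.comp_hasDerivAt z (hX z)).congr_deriv ?_
    simp [A, fst, snd]
  · refine (hasFDerivAt_snd.comp_hasDerivAt z (hX z)).congr_deriv ?_
    simp [A, fst, snd]

namespace IsHillSol

variable {q q₁ q₂ w w' w₁ w₁' w₂ w₂' : ℝ → ℝ}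

theorem continuous (h : IsHillSol q w w') : Continuous w :=
  continuous_iff_continuousAt.2 fun z => (h z).1.continuousAt

theorem continuous_deriv (h : IsHillSol q w w') : Continuous w' :=
  continuous_iff_continuousAt.2 fun z => (h z).2.continuousAt

theorem hasDerivAt_wronskian (h₁ : IsHillSol q₁ w₁ w₁') (h₂ : IsHillSol q₂ w₂ w₂') (z : ℝ) :
    HasDerivAt (fun z => w₁' z * w₂ z - w₁ z * w₂' z) ((q₂ z - q₁ z) * (w₁ z * w₂ z)) z := by
  have := ((h₁ z).2.mul (h₂ z).1).sub ((h₁ z).1.mul (h₂ z).2)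
  refine this.congr_deriv ?_
  ring

theorem wronskian_eq (h₁ : IsHillSol q w₁ w₁') (h₂ : IsHillSol q w₂ w₂') (x y : ℝ) :
    w₁' x * w₂ x - w₁ x * w₂' x = w₁' y * w₂ y - w₁ y * w₂' y :=
  is_const_of_deriv_eq_zero
    (fun z => (h₁.hasDerivAt_wronskian h₂ z).differentiableAt)
    (fun z => by rw [(h₁.hasDerivAt_wronskian h₂ z).deriv]; ring) x y

theorem wronskian_strictAntiOn (h₁ : IsHillSol q₁ w₁ w₁') (h₂ : IsHillSol q₂ w₂ w₂')
    (hq : ∀ z, q₂ z < q₁ z) {a b : ℝ} (hw : ∀ z ∈ Set.Ioo a b, 0 < w₁ z * w₂ z) :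
    StrictAntiOn (fun z => w₁' z * w₂ z - w₁ z * w₂' z) (Set.Icc a b) := by
  refine strictAntiOn_of_deriv_neg (convex_Icc a b)
    (fun z _ => (h₁.hasDerivAt_wronskian h₂ z).continuousAt.continuousWithinAt) fun z hz => ?_
  rw [interior_Icc] at hz
  rw [(h₁.hasDerivAt_wronskian h₂ z).deriv]
  exact mul_neg_of_neg_of_pos (sub_neg.2 (hq z)) (hw z hz)

theorem comb (h₁ : IsHillSol q w₁ w₁') (h₂ : IsHillSol q w₂ w₂') (α β : ℝ) :
    IsHillSol q (fun z => α * w₁ z + β * w₂ z) (fun z => α * w₁' z + β * w₂' z) := fun z =>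
  ⟨((h₁ z).1.const_mul α).add ((h₂ z).1.const_mul β),
    (((h₁ z).2.const_mul α).add ((h₂ z).2.const_mul β)).congr_deriv (by ring)⟩

theorem comp_add_const (h : IsHillSol q w w') {T : ℝ} (hT : ∀ z, q (z + T) = q z) :
    IsHillSol q (fun z => w (z + T)) (fun z => w' (z + T)) := fun z =>
  ⟨(h (z + T)).1.comp_add_const z T, by simpa [hT] using (h (z + T)).2.comp_add_const z T⟩

theorem comp_const_sub (h : IsHillSol q w w') {T : ℝ} (hT : ∀ z, q (T - z) = q z) :
    IsHillSol q (fun z => w (T - z)) (fun z => -w' (T - z)) := fun z =>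
  ⟨(h (T - z)).1.comp_const_sub T z,
    (((h (T - z)).2.comp_const_sub T z).neg).congr_deriv (by rw [hT]; ring)⟩

theorem contDiff (h : IsHillSol q w w') (hq : ContDiff ℝ (⊤ : ℕ∞) q) :
    ContDiff ℝ (⊤ : ℕ∞) w ∧ ContDiff ℝ (⊤ : ℕ∞) w' := by
  have hd : deriv w = w' := funext fun z => (h z).1.deriv
  have hd' : deriv w' = fun z => -(q z * w z) := funext fun z => (h z).2.deriv
  have key : ∀ n : ℕ, ContDiff ℝ n w ∧ ContDiff ℝ n w' := by
    intro n
    induction n with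
    | zero => exact ⟨contDiff_zero.2 h.continuous, contDiff_zero.2 h.continuous_deriv⟩
    | succ n ih =>
      have hqn : ContDiff ℝ n q := hq.of_le (by exact_mod_cast le_top)
      rw [Nat.cast_succ]
      constructor
      · refine contDiff_succ_iff_deriv.2 ⟨fun z => (h z).1.differentiableAt, by simp, ?_⟩
        rw [hd]; exact ih.2
      · refine contDiff_succ_iff_deriv.2 ⟨fun z => (h z).2.differentiableAt, by simp, ?_⟩
        rw [hd']; exact (hqn.mul ih.1).neg
  exact ⟨contDiff_infty.2 fun n => (key n).1, contDiff_infty.2 fun n => (key n).2⟩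

end IsHillSol

/-- `c` and `s` are the fundamental solutions of `w'' + q w = 0` normalized at the origin. -/
structure IsFundPair (q c c' s s' : ℝ → ℝ) : Prop where
  solc : IsHillSol q c c'
  sols : IsHillSol q s s'
  c_zero : c 0 = 1
  c'_zero : c' 0 = 0
  s_zero : s 0 = 0
  s'_zero : s' 0 = 1

namespace IsFundPair

variable {q c c' s s' w w' : ℝ → ℝ}

theorem det (h : IsFundPair q c c' s s') (z : ℝ) : c z * s' z - c' z * s z = 1 := by
  have := h.solc.wronskian_eq h.sols z 0
  rw [h.c_zero, h.c'_zero, h.s_zero, h.s'_zero] at this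
  linarith

theorem repr (h : IsFundPair q c c' s s') (hw : IsHillSol q w w') (z : ℝ) :
    w z = w 0 * c z + w' 0 * s z ∧ w' z = w 0 * c' z + w' 0 * s' z := by
  have h₁ := hw.wronskian_eq h.sols z 0
  have h₂ := hw.wronskian_eq h.solc z 0
  rw [h.s_zero, h.s'_zero] at h₁
  rw [h.c_zero, h.c'_zero] at h₂
  have hd := h.det z
  constructor
  · linear_combination (-w z) * hd - c z * h₁ + s z * h₂
  · linear_combination (-w' z) * hd - c' z * h₁ + s' z * h₂

end IsFundPair

open Filter Topology in
/-- A continuous function which starts out positive and is not positive throughout `(a, b]` has a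
first zero. -/
theorem exists_first_zero {f : ℝ → ℝ} (hf : Continuous f) {a b : ℝ} (hab : a < b)
    (ha : ∀ᶠ z in 𝓝[>] a, 0 < f z) (hb : f b ≤ 0) :
    ∃ x ∈ Set.Ioc a b, f x = 0 ∧ ∀ z ∈ Set.Ioo a x, 0 < f z := by
  obtain ⟨c, hac, hc⟩ := (mem_nhdsGT_iff_exists_Ioo_subset).1 ha
  have hac' : a < c := hac
  set d := (a + min b c) / 2 with hd
  have had : a < d := by have := lt_min hab hac'; linarith
  have hdc : d < min b c := by have := lt_min hab hac'; linarith
  set K := {z | z ∈ Set.Icc d b ∧ f z ≤ 0} with hK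
  have hKc : IsCompact K :=
    isCompact_Icc.inter_right (isClosed_le hf continuous_const)
  have hKn : K.Nonempty := ⟨b, ⟨(hdc.trans_le (min_le_left _ _)).le, le_rfl⟩, hb⟩
  have hx : sInf K ∈ K := hKc.sInf_mem hKn
  have hlt : ∀ z ∈ Set.Ioo a (sInf K), 0 < f z := by
    intro z hz
    by_contra hneg
    rcases lt_or_ge z d with h | h
    · exact hneg (hc ⟨hz.1, h.trans (hdc.trans_le (min_le_right _ _))⟩)
    · exact absurd (csInf_le hKc.bddBelow
        (show z ∈ K from ⟨⟨h, hz.2.le.trans hx.1.2⟩, not_lt.1 hneg⟩)) (not_le.2 hz.2)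
  have hpos : a < sInf K := had.trans_le hx.1.1
  refine ⟨sInf K, ⟨hpos, hx.1.2⟩, le_antisymm hx.2 ?_, hlt⟩
  have hcl : sInf K ∈ closure (Set.Ioo a (sInf K)) := by
    rw [closure_Ioo hpos.ne]; exact ⟨hpos.le, le_rfl⟩
  exact closure_minimal (fun z hz => (hlt z hz).le) (isClosed_le continuous_const hf) hcl

open Filter Topology in
theorem HasDerivAt.nonpos_of_forall_Ioo_pos {f : ℝ → ℝ} {f' a x : ℝ} (h : HasDerivAt f f' x)
    (hax : a < x) (hx : f x = 0) (hpos : ∀ z ∈ Set.Ioo a x, 0 < f z) : f' ≤ 0 := by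
  have hs := (hasDerivAt_iff_tendsto_slope_left_right.1 h).1
  refine le_of_tendsto hs ?_
  filter_upwards [Ioo_mem_nhdsLT hax] with z hz
  rw [slope_def_field, hx]
  exact (div_neg_of_pos_of_neg (by linarith [hpos z hz]) (by linarith [hz.2])).le

open Filter Topology in
theorem HasDerivAt.eventually_pos_right {f : ℝ → ℝ} {f' x : ℝ} (h : HasDerivAt f f' x)
    (hx : f x = 0) (hf' : 0 < f') : ∀ᶠ z in 𝓝[>] x, 0 < f z := by
  have hs := (hasDerivAt_iff_tendsto_slope_left_right.1 h).2
  filter_upwards [hs.eventually (lt_mem_nhds hf'), self_mem_nhdsWithin] with z hz hzx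
  rw [slope_def_field, hx, sub_zero] at hz
  have hzx' : (0:ℝ) < z - x := sub_pos.2 hzx
  exact (div_pos_iff_of_pos_right hzx').1 hz

namespace IsHillSol

variable {q₁ q₂ w₁ w₁' w₂ w₂' : ℝ → ℝ}

open Filter Topology in
/-- Sturm comparison: lowering the potential keeps solutions positive. -/
theorem pos_of_sturm (h₁ : IsHillSol q₁ w₁ w₁') (h₂ : IsHillSol q₂ w₂ w₂')
    (hq : ∀ z, q₂ z < q₁ z) {a b : ℝ} (hW : w₁' a * w₂ a = w₁ a * w₂' a)
    (ha : ∀ᶠ z in 𝓝[>] a, 0 < w₂ z) (hpos : ∀ z ∈ Set.Ioo a b, 0 < w₁ z) :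
    ∀ z ∈ Set.Ioc a b, 0 < w₂ z := by
  intro z hz
  by_contra hneg
  obtain ⟨x, hx, hx0, hxpos⟩ := exists_first_zero h₂.continuous hz.1 ha (not_lt.1 hneg)
  have hxb : x ≤ b := hx.2.trans hz.2
  have hanti := h₁.wronskian_strictAntiOn h₂ hq (a := a) (b := x) fun y hy =>
    mul_pos (hpos y ⟨hy.1, hy.2.trans_le hxb⟩) (hxpos y hy)
  have hlt := hanti (Set.left_mem_Icc.2 hx.1.le) (Set.right_mem_Icc.2 hx.1.le) hx.1
  simp only [hx0, hW, sub_self, mul_zero, zero_sub, Left.neg_neg_iff] at hlt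
  have hw₁ : 0 ≤ w₁ x := by
    have hcl : x ∈ closure (Set.Ioo a x) := by
      rw [closure_Ioo hx.1.ne]; exact ⟨hx.1.le, le_rfl⟩
    exact closure_minimal (fun y hy => (hpos y ⟨hy.1, hy.2.trans_le hxb⟩).le)
      (isClosed_le continuous_const h₁.continuous) hcl
  have := (h₂ x).1.nonpos_of_forall_Ioo_pos hx.1 hx0 hxpos
  nlinarith

/-- Continuous dependence on the potential. -/
theorem abs_sub_le (h₁ : IsHillSol q₁ w₁ w₁') (h₂ : IsHillSol q₂ w₂ w₂') (h0 : w₁ 0 = w₂ 0)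
    (h0' : w₁' 0 = w₂' 0) {K δ B T : ℝ} (hT : 0 ≤ T) (hK : 1 ≤ K) (hδ : 0 ≤ δ)
    (hq₁ : ∀ z, |q₁ z| ≤ K)
    (hq : ∀ z, |q₁ z - q₂ z| ≤ δ) (hB : ∀ z ∈ Set.Icc 0 T, |w₂ z| ≤ B) :
    |w₁ T - w₂ T| ≤ δ * (B * exp (K * T)) ∧ |w₁' T - w₂' T| ≤ δ * (B * exp (K * T)) := by
  have hB0 : 0 ≤ B := (abs_nonneg _).trans (hB 0 ⟨le_rfl, hT⟩)
  let f : ℝ → ℝ × ℝ := fun z => (w₁ z - w₂ z, w₁' z - w₂' z)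
  have hf : ∀ z, HasDerivAt f (w₁' z - w₂' z, -(q₁ z * w₁ z) - -(q₂ z * w₂ z)) z := fun z =>
    ((h₁ z).1.sub (h₂ z).1).prodMk ((h₁ z).2.sub (h₂ z).2)
  have key := norm_le_gronwallBound_of_norm_deriv_right_le (f := f) (δ := 0) (K := K)
    (ε := δ * B) (a := 0) (b := T)
    (fun z _ => (hf z).continuousAt.continuousWithinAt)
    (fun z _ => (hf z).hasDerivWithinAt) (by simp [f, h0, h0']) (fun z hz => ?_) T
    ⟨hT, le_rfl⟩
  · have hle : ‖f T‖ ≤ δ * (B * exp (K * T)) := by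
      refine key.trans ?_
      rw [gronwallBound_of_K_ne_0 (by positivity)]
      simp only [zero_mul, zero_add, sub_zero]
      have hexp : 1 ≤ exp (K * T) := one_le_exp (by positivity)
      have : δ * B / K ≤ δ * B := div_le_self (by positivity) hK
      nlinarith [mul_le_mul this (by linarith : exp (K * T) - 1 ≤ exp (K * T)) (by linarith)
        (by positivity)]
    exact ⟨(norm_fst_le (f T)).trans hle, (norm_snd_le (f T)).trans hle⟩
  · have e₁ : |w₁ z - w₂ z| ≤ ‖f z‖ := norm_fst_le (f z)
    have e₂ : |w₁' z - w₂' z| ≤ ‖f z‖ := norm_snd_le (f z)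
    have hn : 0 ≤ ‖f z‖ := norm_nonneg _
    rw [Prod.norm_def]
    refine max_le ?_ ?_
    · rw [Real.norm_eq_abs]
      nlinarith [mul_nonneg hδ hB0]
    · rw [Real.norm_eq_abs]
      have : -(q₁ z * w₁ z) - -(q₂ z * w₂ z) =
          -(q₁ z * (w₁ z - w₂ z)) - (q₁ z - q₂ z) * w₂ z := by ring
      rw [this]
      refine (abs_sub _ _).trans ?_
      rw [abs_neg, abs_mul, abs_mul]
      have := hB z ⟨hz.1, hz.2.le⟩
      have := hq z
      have := hq₁ z
      gcongr

end IsHillSol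

namespace IsFundPair

variable {q c c' s s' : ℝ → ℝ} {T : ℝ}

open Filter Topology in
theorem eventually_c_pos (h : IsFundPair q c c' s s') : ∀ᶠ z in 𝓝[>] (0:ℝ), 0 < c z :=
  nhdsWithin_le_nhds (h.solc.continuous.continuousAt.eventually
    (lt_mem_nhds (by rw [h.c_zero]; exact one_pos)))

open Filter Topology in
theorem eventually_s_pos (h : IsFundPair q c c' s s') : ∀ᶠ z in 𝓝[>] (0:ℝ), 0 < s z :=
  (h.sols 0).1.eventually_pos_right h.s_zero (by rw [h.s'_zero]; exact one_pos)

theorem c_mul_s_lt (h : IsFundPair q c c' s s') (hs : ∀ z ∈ Set.Ioc 0 T, 0 < s z) {x y : ℝ}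
    (hx : 0 < x) (hxy : x < y) (hy : y ≤ T) : c y * s x < c x * s y := by
  have hpos : ∀ z ∈ Set.Icc x y, 0 < s z := fun z hz =>
    hs z ⟨hx.trans_le hz.1, hz.2.trans hy⟩
  have hder : ∀ z ∈ Set.Icc x y, HasDerivAt (fun z => c z / s z)
      ((c' z * s z - c z * s' z) / s z ^ 2) z := fun z hz =>
    (h.solc z).1.div (h.sols z).1 (hpos z hz).ne'
  have hanti : StrictAntiOn (fun z => c z / s z) (Set.Icc x y) := by
    refine strictAntiOn_of_deriv_neg (convex_Icc x y)
      (fun z hz => (hder z hz).continuousAt.continuousWithinAt) fun z hz => ?_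
    have hz' := interior_subset hz
    rw [(hder z hz').deriv]
    have := h.det z
    exact div_neg_of_neg_of_pos (by linarith) (pow_pos (hpos z hz') 2)
  have hlt := hanti (Set.left_mem_Icc.2 hxy.le) (Set.right_mem_Icc.2 hxy.le) hxy
  exact (div_lt_div_iff₀ (hpos y ⟨hxy.le, le_rfl⟩) (hpos x ⟨le_rfl, hxy.le⟩)).1 hlt

theorem c_neg_of_nonpos (h : IsFundPair q c c' s s') (hs : ∀ z ∈ Set.Ioc 0 T, 0 < s z) {x y : ℝ}
    (hx : 0 < x) (hxy : x < y) (hy : y ≤ T) (hc : c x ≤ 0) : c y < 0 := by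
  have := h.c_mul_s_lt hs hx hxy hy
  have hsx := hs x ⟨hx, hxy.le.trans hy⟩
  have hsy := hs y ⟨hx.trans hxy, hy⟩
  by_contra hcy
  nlinarith [mul_nonneg (not_lt.1 hcy) hsx.le]

theorem c_pos_of_nonneg (h : IsFundPair q c c' s s') (hs : ∀ z ∈ Set.Ioc 0 T, 0 < s z) {x y : ℝ}
    (hx : 0 < x) (hxy : x < y) (hy : y ≤ T) (hc : 0 ≤ c y) : 0 < c x := by
  by_contra hcx
  exact absurd (h.c_neg_of_nonpos hs hx hxy hy (not_lt.1 hcx)) (not_lt.2 hc)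

/-- When `q > 0`, the cosine-type solution is decreasing as long as it is positive. -/
theorem c'_neg_of_c_nonneg (h : IsFundPair q c c' s s') (hq : ∀ z, 0 < q z)
    (hs : ∀ z ∈ Set.Ioc 0 T, 0 < s z) (hT : 0 < T) (hc : 0 ≤ c T) : c' T < 0 := by
  have hanti : StrictAntiOn c' (Set.Icc 0 T) := by
    refine strictAntiOn_of_deriv_neg (convex_Icc 0 T)
      (fun z _ => (h.solc z).2.continuousAt.continuousWithinAt) fun z hz => ?_
    rw [interior_Icc] at hz
    rw [(h.solc z).2.deriv]
    have := h.c_pos_of_nonneg hs hz.1 hz.2 le_rfl hc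
    exact neg_neg_of_pos (mul_pos (hq z) this)
  have := hanti (Set.left_mem_Icc.2 hT.le) (Set.right_mem_Icc.2 hT.le) hT
  rwa [h.c'_zero] at this

variable {q₁ q₂ c₁ c₁' s₁ s₁' c₂ c₂' s₂ s₂' : ℝ → ℝ}

theorem s_pos_of_lt (h₁ : IsFundPair q₁ c₁ c₁' s₁ s₁') (h₂ : IsFundPair q₂ c₂ c₂' s₂ s₂')
    (hq : ∀ z, q₂ z < q₁ z) (hs : ∀ z ∈ Set.Ioo 0 T, 0 < s₁ z) : ∀ z ∈ Set.Ioc 0 T, 0 < s₂ z :=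
  h₁.sols.pos_of_sturm h₂.sols hq (by simp [h₁.s_zero, h₂.s_zero]) h₂.eventually_s_pos hs

theorem s_wronskian_neg (h₁ : IsFundPair q₁ c₁ c₁' s₁ s₁') (h₂ : IsFundPair q₂ c₂ c₂' s₂ s₂')
    (hq : ∀ z, q₂ z < q₁ z) (hT : 0 < T) (hs₁ : ∀ z ∈ Set.Ioc 0 T, 0 < s₁ z)
    (hs₂ : ∀ z ∈ Set.Ioc 0 T, 0 < s₂ z) : s₁' T * s₂ T < s₁ T * s₂' T := by
  have := h₁.sols.wronskian_strictAntiOn h₂.sols hq (a := 0) (b := T)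
    (fun z hz => mul_pos (hs₁ z ⟨hz.1, hz.2.le⟩) (hs₂ z ⟨hz.1, hz.2.le⟩))
    (Set.left_mem_Icc.2 hT.le) (Set.right_mem_Icc.2 hT.le) hT
  simp only [h₁.s_zero, h₂.s_zero, mul_zero, zero_mul, sub_self] at this
  linarith

theorem c_pos_of_lt (h₁ : IsFundPair q₁ c₁ c₁' s₁ s₁') (h₂ : IsFundPair q₂ c₂ c₂' s₂ s₂')
    (hq : ∀ z, q₂ z < q₁ z) (hs₁ : ∀ z ∈ Set.Ioc 0 T, 0 < s₁ z) (hc : 0 ≤ c₁ T) :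
    ∀ z ∈ Set.Ioc 0 T, 0 < c₂ z :=
  h₁.solc.pos_of_sturm h₂.solc hq (by simp [h₁.c'_zero, h₂.c'_zero]) h₂.eventually_c_pos
    fun _ hz => h₁.c_pos_of_nonneg hs₁ hz.1 hz.2 le_rfl hc

theorem c_wronskian_neg_of_nonneg (h₁ : IsFundPair q₁ c₁ c₁' s₁ s₁')
    (h₂ : IsFundPair q₂ c₂ c₂' s₂ s₂')
    (hq : ∀ z, q₂ z < q₁ z) (hT : 0 < T) (hs₁ : ∀ z ∈ Set.Ioc 0 T, 0 < s₁ z) (hc : 0 ≤ c₁ T) :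
    c₁' T * c₂ T < c₁ T * c₂' T := by
  have hc₂ := h₁.c_pos_of_lt h₂ hq hs₁ hc
  have := h₁.solc.wronskian_strictAntiOn h₂.solc hq (a := 0) (b := T)
    (fun z hz => mul_pos (h₁.c_pos_of_nonneg hs₁ hz.1 hz.2 le_rfl hc) (hc₂ z ⟨hz.1, hz.2.le⟩))
    (Set.left_mem_Icc.2 hT.le) (Set.right_mem_Icc.2 hT.le) hT
  simp only [h₁.c'_zero, h₂.c'_zero, mul_zero, zero_mul, sub_self] at this
  linarith

theorem c_wronskian_neg_of_neg (h₁ : IsFundPair q₁ c₁ c₁' s₁ s₁')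
    (h₂ : IsFundPair q₂ c₂ c₂' s₂ s₂')
    (hq : ∀ z, q₂ z < q₁ z) (hT : 0 < T) (hs₁ : ∀ z ∈ Set.Ioc 0 T, 0 < s₁ z)
    (hs₂ : ∀ z ∈ Set.Ioc 0 T, 0 < s₂ z) (hc : c₂ T < 0) :
    c₁' T * c₂ T < c₁ T * c₂' T := by
  obtain ⟨x, hx, hx0⟩ := intermediate_value_Icc' hT.le h₂.solc.continuous.continuousOn
    (show (0:ℝ) ∈ Set.Icc (c₂ T) (c₂ 0) from ⟨hc.le, by rw [h₂.c_zero]; exact zero_le_one⟩)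
  have hx1 : 0 < x := hx.1.lt_of_ne (by rintro rfl; simp [h₂.c_zero] at hx0)
  have hx2 : x < T := hx.2.lt_of_ne (by rintro rfl; exact hc.ne hx0)
  have hc₁ : c₁ x < 0 := by
    by_contra hcx
    have := h₁.c_pos_of_lt h₂ hq (fun z hz => hs₁ z ⟨hz.1, hz.2.trans hx2.le⟩)
      (not_lt.1 hcx) x ⟨hx1, le_rfl⟩
    exact this.ne' hx0
  have hanti := h₁.solc.wronskian_strictAntiOn h₂.solc hq (a := x) (b := T)
    (fun z hz => mul_pos_of_neg_of_neg
      (h₁.c_neg_of_nonpos hs₁ hx1 hz.1 hz.2.le hc₁.le)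
      (h₂.c_neg_of_nonpos hs₂ hx1 hz.1 hz.2.le hx0.le))
    (Set.left_mem_Icc.2 hx2.le) (Set.right_mem_Icc.2 hx2.le) hx2
  simp only [hx0, mul_zero, zero_sub] at hanti
  have hdet := h₂.det x
  rw [hx0, zero_mul, zero_sub] at hdet
  have hsx := hs₂ x ⟨hx1, hx2.le⟩
  have hc₂' : c₂' x < 0 := by
    by_contra hcx
    nlinarith [mul_nonneg (not_lt.1 hcx) hsx.le]
  nlinarith [mul_pos_of_neg_of_neg hc₁ hc₂']

theorem c'_neg_of_lt (h₁ : IsFundPair q₁ c₁ c₁' s₁ s₁')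
    (h₂ : IsFundPair q₂ c₂ c₂' s₂ s₂')
    (hq : ∀ z, q₂ z < q₁ z) (hq₂ : ∀ z, 0 < q₂ z) (hT : 0 < T)
    (hs₁ : ∀ z ∈ Set.Ioc 0 T, 0 < s₁ z)
    (hs₂ : ∀ z ∈ Set.Ioc 0 T, 0 < s₂ z) (hc : c₁' T ≤ 0) : c₂' T < 0 := by
  rcases lt_or_ge (c₂ T) 0 with hc₂ | hc₂
  · by_contra hc₂'
    have hW := h₁.c_wronskian_neg_of_neg h₂ hq hT hs₁ hs₂ hc₂
    have hc₁ : 0 ≤ c₁ T := by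
      by_contra hc₁
      nlinarith [mul_nonneg_of_nonpos_of_nonpos hc hc₂.le,
        mul_nonneg (not_lt.1 hc₂') (neg_nonneg.2 (not_le.1 hc₁).le)]
    exact absurd (h₁.c_pos_of_lt h₂ hq hs₁ hc₁ T ⟨hT, le_rfl⟩) (not_lt.2 hc₂.le)
  · exact h₂.c'_neg_of_c_nonneg hq₂ hs₂ hT hc₂

end IsFundPair

open Filter Topology in
/-- A continuous function on `[0, ∞)` that can only change sign upwards has a unique zero. -/
theorem exists_sign_change {f : ℝ → ℝ} (hf : ContinuousOn f (Set.Ici 0)) (h0 : f 0 < 0)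
    (htop : ∀ᶠ x in atTop, 0 < f x) (hup : ∀ x y, 0 < x → x < y → 0 ≤ f x → 0 < f y) :
    ∃ x₀, 0 < x₀ ∧ f x₀ = 0 ∧ (∀ x, 0 < x → x < x₀ → f x < 0) ∧ ∀ x, x₀ < x → 0 < f x := by
  obtain ⟨X, hX, hX0⟩ := (htop.and (eventually_gt_atTop 0)).exists
  obtain ⟨x₀, hx₀, hx₀0⟩ := intermediate_value_Icc hX0.le
    (hf.mono Set.Icc_subset_Ici_self) (show (0:ℝ) ∈ Set.Icc (f 0) (f X) from ⟨h0.le, hX.le⟩)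
  have hpos : 0 < x₀ := hx₀.1.lt_of_ne (by rintro rfl; exact h0.ne hx₀0)
  refine ⟨x₀, hpos, hx₀0, fun x hx hxx₀ => ?_, fun x hx => hup x₀ x hpos hx hx₀0.ge⟩
  by_contra hneg
  exact (hup x x₀ hx hxx₀ (not_lt.1 hneg)).ne' hx₀0

open Filter Topology in
/-- The values at the half period of the fundamental solutions, as functions of the spectral
parameter: the sign and comparison information which determines the band structure. -/
structure IsHalfPeriodData (c c' s s' : ℝ → ℝ) : Prop where
  continuousOn_c : ContinuousOn c (Set.Ici 0)
  continuousOn_c' : ContinuousOn c' (Set.Ici 0)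
  continuousOn_s' : ContinuousOn s' (Set.Ici 0)
  det : ∀ x, 0 ≤ x → c x * s' x - c' x * s x = 1
  s_pos : ∀ x, 0 < x → 0 < s x
  c_zero_neg : c 0 < 0
  s'_zero_neg : s' 0 < 0
  c'_zero_pos : 0 < c' 0
  c_top : Tendsto c atTop (𝓝 1)
  s'_top : Tendsto s' atTop (𝓝 1)
  c'_top : ∀ᶠ x in atTop, c' x < 0
  c_up : ∀ x y, 0 < x → x < y → 0 ≤ c x → 0 < c y
  c'_down : ∀ x y, 0 < x → x < y → c' x ≤ 0 → c' y < 0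
  s_wronskian : ∀ x y, 0 < x → x < y → s' x * s y < s x * s' y
  c_wronskian : ∀ x y, 0 < x → x < y → c y < 0 ∨ 0 ≤ c x → c' x * c y < c x * c' y

namespace IsHalfPeriodData

variable {c c' s s' : ℝ → ℝ}

theorem s'_up (h : IsHalfPeriodData c c' s s') (x y : ℝ) (hx : 0 < x) (hxy : x < y)
    (hs : 0 ≤ s' x) : 0 < s' y := by
  have := h.s_wronskian x y hx hxy
  have h₁ := h.s_pos x hx
  have h₂ := h.s_pos y (hx.trans hxy)
  by_contra hy
  nlinarith [mul_nonneg hs h₂.le, mul_nonneg h₁.le (neg_nonneg.2 (not_lt.1 hy))]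

theorem mul_lt_of_neg (h : IsHalfPeriodData c c' s s') {x y : ℝ} (hx : 0 < x) (hxy : x < y)
    (hcy : c y < 0) (hsy : s' y < 0) (hcx' : c' x < 0) : c y * s' y < c x * s' x := by
  have hs := h.s_wronskian x y hx hxy
  have hc := h.c_wronskian x y hx hxy (.inl hcy)
  have h₁ := h.s_pos x hx
  have h₂ := h.s_pos y (hx.trans hxy)
  have d₁ := h.det x hx.le
  have d₂ := h.det y (hx.trans hxy).le
  have p : (c' x * c y) * (-s' y * s x) < (c x * c' y) * (-s' x * s y) :=
    mul_lt_mul'' hc (by linarith) (mul_nonneg_of_nonpos_of_nonpos hcx'.le hcy.le)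
      (mul_nonneg (by linarith) h₁.le)
  have p' : -(c' x * s x) * (c y * s' y) < -(c' y * s y) * (c x * s' x) := by linarith
  rw [show c' x * s x = c x * s' x - 1 by linarith,
    show c' y * s y = c y * s' y - 1 by linarith] at p'
  linarith

theorem mul_lt_of_pos (h : IsHalfPeriodData c c' s s') {x y : ℝ} (hx : 0 < x) (hxy : x < y)
    (hcx : 0 < c x) (hsx : 0 < s' x) (hcy' : c' y < 0) : c x * s' x < c y * s' y := by
  have hs := h.s_wronskian x y hx hxy
  have hc := h.c_wronskian x y hx hxy (.inr hcx.le)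
  have h₁ := h.s_pos x hx
  have h₂ := h.s_pos y (hx.trans hxy)
  have d₁ := h.det x hx.le
  have d₂ := h.det y (hx.trans hxy).le
  have p : (c x * -c' y) * (s' x * s y) < (-c' x * c y) * (s x * s' y) :=
    mul_lt_mul'' (by linarith) hs (mul_nonneg hcx.le (by linarith))
      (mul_nonneg hsx.le h₂.le)
  have p' : -(c' y * s y) * (c x * s' x) < -(c' x * s x) * (c y * s' y) := by linarith
  rw [show c' x * s x = c x * s' x - 1 by linarith,
    show c' y * s y = c y * s' y - 1 by linarith] at p'
  linarith

open Filter Topology Polynomial in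
/-- Counting the periodic eigenvalues, with their multiplicities `D`, from the discriminant
`2 * (2 * c * s' - 1)`. -/
theorem sum_multiplicity (h : IsHalfPeriodData c c' s s') {N : ℕ} (hN : 1 ≤ N) {D : ℝ → ℕ}
    (hD0 : ∀ x, 0 < x → (Chebyshev.T ℝ N).eval (2 * (c x * s' x) - 1) ≠ 1 → D x = 0)
    (hD2 : ∀ x, 0 < x → (Chebyshev.T ℝ N).eval (2 * (c x * s' x) - 1) = 1 →
      |2 * (c x * s' x) - 1| < 1 ∨ (c x = 0 ∧ s' x = 0) → D x = 2)
    (hD1 : ∀ x, 0 < x → (Chebyshev.T ℝ N).eval (2 * (c x * s' x) - 1) = 1 →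
      |2 * (c x * s' x) - 1| = 1 → (c' x = 0 ∨ c x ≠ 0 ∨ s' x ≠ 0) → D x = 1) :
    ∃ hfin : {x : ℝ | 0 < x ∧ D x ≠ 0}.Finite, ∑ x ∈ hfin.toFinset, D x = 2 * N - 1 := by
  set a : ℝ → ℝ := fun x => 2 * (c x * s' x) - 1 with ha
  have hN0 : N ≠ 0 := by omega
  have hNR : (0:ℝ) < N := by exact_mod_cast hN
  have ha_cont : ContinuousOn a (Set.Ici 0) :=
    (continuousOn_const.mul (h.continuousOn_c.mul h.continuousOn_s')).sub continuousOn_const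
  obtain ⟨x₀, hx₀, hc'x₀, hc'neg, hc'pos⟩ := exists_sign_change (f := fun x => -c' x)
    h.continuousOn_c'.neg (by simpa using h.c'_zero_pos)
    (by filter_upwards [h.c'_top] with x hx; linarith)
    (fun x y hx hxy hcx => by have := h.c'_down x y hx hxy (by linarith); linarith)
  obtain ⟨m₁, hm₁, hcm₁, hcneg, hcpos⟩ := exists_sign_change h.continuousOn_c h.c_zero_neg
    (h.c_top.eventually (lt_mem_nhds one_pos)) h.c_up
  obtain ⟨m₂, hm₂, hsm₂, hsneg, hspos⟩ := exists_sign_change h.continuousOn_s' h.s'_zero_neg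
    (h.s'_top.eventually (lt_mem_nhds one_pos)) h.s'_up
  have hc'x₀ : c' x₀ = 0 := by linarith
  replace hc'neg : ∀ x, 0 < x → x < x₀ → 0 < c' x := fun x hx hxx => by
    have := hc'neg x hx hxx; linarith
  replace hc'pos : ∀ x, x₀ < x → c' x < 0 := fun x hx => by
    have := hc'pos x hx; linarith
  have hlt_of_mul : ∀ x, 0 < x → c x * s' x ≤ 0 → x₀ < x := by
    intro x hx hcs
    by_contra hle
    have hd := h.det x hx.le
    have hs := h.s_pos x hx
    have : 0 ≤ c' x := by
      rcases (not_lt.1 hle).lt_or_eq with hlt | rfl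
      · exact (hc'neg x hx hlt).le
      · exact hc'x₀.ge
    nlinarith [mul_nonneg this hs.le]
  have hx₀m₁ : x₀ < m₁ := hlt_of_mul m₁ hm₁ (by simp [hcm₁])
  have hx₀m₂ : x₀ < m₂ := hlt_of_mul m₂ hm₂ (by simp [hsm₂])
  set l := min m₁ m₂ with hl
  set r := max m₁ m₂ with hr
  have hx₀l : x₀ < l := lt_min hx₀m₁ hx₀m₂
  have hlr : l ≤ r := min_le_max
  have har : a r = -1 := by
    rcases max_choice m₁ m₂ with e | e <;> simp [ha, hr, e, hcm₁, hsm₂]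
  have hal : a l = -1 := by
    rcases min_choice m₁ m₂ with e | e <;> simp [ha, hl, e, hcm₁, hsm₂]
  have hax₀ : a x₀ = 1 := by
    have := h.det x₀ hx₀.le
    rw [hc'x₀] at this
    simp only [ha]; linarith
  have hleft : ∀ x ∈ Set.Ioo x₀ l, c x < 0 ∧ s' x < 0 ∧ c' x < 0 := fun x hx =>
    ⟨hcneg x (hx₀.trans hx.1) (hx.2.trans_le (min_le_left _ _)),
      hsneg x (hx₀.trans hx.1) (hx.2.trans_le (min_le_right _ _)), hc'pos x hx.1⟩
  have hright : ∀ x, r < x → 0 < c x ∧ 0 < s' x ∧ c' x < 0 := fun x hx =>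
    ⟨hcpos x ((le_max_left _ _).trans_lt hx), hspos x ((le_max_right _ _).trans_lt hx),
      hc'pos x (hx₀l.trans_le (hlr.trans hx.le))⟩
  have hr0 : 0 < r := hx₀.trans (hx₀l.trans_le hlr)
  have habs : ∀ x, 0 < x → 0 < c x * s' x → c' x < 0 → |a x| < 1 := by
    intro x hx hcs hc'
    have hd := h.det x hx.le
    have := mul_neg_of_neg_of_pos hc' (h.s_pos x hx)
    rw [abs_lt]
    constructor <;> simp only [ha] <;> linarith
  have hanti : Set.InjOn a (Set.Ioo x₀ l) := by
    refine StrictAntiOn.injOn fun x hx y hy hxy => ?_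
    have := h.mul_lt_of_neg (hx₀.trans hx.1) hxy (hleft y hy).1 (hleft y hy).2.1
      (hleft x hx).2.2
    simp only [ha]; linarith
  have hmono : Set.InjOn a (Set.Ioi r) := by
    refine StrictMonoOn.injOn fun x hx y hy hxy => ?_
    have := h.mul_lt_of_pos (hr0.trans hx) hxy (hright x hx).1 (hright x hx).2.1
      (hright y hy).2.2
    simp only [ha]; linarith
  have hL : ∀ t ∈ Set.Ioo (-1:ℝ) 1, ∃ x ∈ Set.Ioo x₀ l, a x = t := by
    intro t ht
    have hsub := intermediate_value_Ioo' hx₀l.le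
      (ha_cont.mono ((Set.Icc_subset_Ici_self).trans (Set.Ici_subset_Ici.2 hx₀.le)))
    rw [hal, hax₀] at hsub
    exact hsub ht
  have ha_top : Tendsto a atTop (𝓝 1) := by
    have := ((h.c_top.mul h.s'_top).const_mul 2).sub_const 1
    norm_num at this
    exact this
  have hR : ∀ t ∈ Set.Ioo (-1:ℝ) 1, ∃ x, r < x ∧ a x = t := by
    intro t ht
    obtain ⟨X, hX, hrX⟩ :=
      ((ha_top.eventually (lt_mem_nhds ht.2)).and (eventually_gt_atTop r)).exists
    have hsub := intermediate_value_Ioo hrX.le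
      (ha_cont.mono ((Set.Icc_subset_Ici_self).trans (Set.Ici_subset_Ici.2 hr0.le)))
    rw [har] at hsub
    obtain ⟨x, hx, hxt⟩ := hsub ⟨ht.1, hX⟩
    exact ⟨x, hx.1, hxt⟩
  choose! fL hfL hfL' using hL
  choose! fR hfR hfR' using hR
  set J : Finset ℕ := Finset.Ico 1 ((N + 1) / 2) with hJ
  set t : ℕ → ℝ := fun j => cos ((2 * j : ℕ) * π / N) with ht
  have hang : ∀ j ∈ J, (2 * j : ℕ) * π / N ∈ Set.Ioo 0 π := by
    intro j hj
    rw [hJ, Finset.mem_Ico] at hj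
    have h1 : (0:ℝ) < (2 * j : ℕ) := by exact_mod_cast (by omega : 0 < 2 * j)
    have h2 : ((2 * j : ℕ) : ℝ) < N := by exact_mod_cast (by omega : 2 * j < N)
    refine ⟨by positivity, ?_⟩
    rw [div_lt_iff₀ hNR, mul_comm]
    exact mul_lt_mul_of_pos_left h2 pi_pos
  have htJ : ∀ j ∈ J, t j ∈ Set.Ioo (-1:ℝ) 1 := by
    intro j hj
    have := hang j hj
    constructor
    · have := strictAntiOn_cos ⟨this.1.le, this.2.le⟩ ⟨pi_pos.le, le_rfl⟩ this.2
      rwa [cos_pi] at this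
    · have := strictAntiOn_cos ⟨le_rfl, pi_pos.le⟩ ⟨this.1.le, this.2.le⟩ this.1
      rwa [cos_zero] at this
  have htinj : Set.InjOn t J := by
    intro i hi j hj hij
    have h1 := hang i hi
    have h2 := hang j hj
    have := injOn_cos ⟨h1.1.le, h1.2.le⟩ ⟨h2.1.le, h2.2.le⟩ hij
    rw [div_left_inj' hNR.ne', mul_left_inj' pi_ne_zero] at this
    have : 2 * i = 2 * j := by exact_mod_cast this
    omega
  have hT1 : ∀ j ∈ J, (Chebyshev.T ℝ N).eval (t j) = 1 := by
    intro j hj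
    rw [hJ, Finset.mem_Ico] at hj
    exact (Chebyshev.eval_T_real_eq_one_iff hN0 _).2 ⟨2 * j, by omega, even_two_mul j, rfl⟩
  have hT2 : ∀ y, |y| < 1 → (Chebyshev.T ℝ N).eval y = 1 → ∃ j ∈ J, y = t j := by
    intro y hy hTy
    obtain ⟨k, hk, ⟨j, hj⟩, hyk⟩ := (Chebyshev.eval_T_real_eq_one_iff hN0 _).1 hTy
    have hk2 : k = 2 * j := by omega
    subst hk2
    refine ⟨j, ?_, hyk⟩
    rw [hJ, Finset.mem_Ico]
    constructor
    · by_contra hj0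
      have : j = 0 := by omega
      simp [hyk, this] at hy
    · by_contra hj0
      have : 2 * j = N := by omega
      rw [this, mul_div_cancel_left₀ _ hNR.ne', cos_pi] at hyk
      simp [hyk] at hy
  have hTneg : (Chebyshev.T ℝ N).eval (-1) = 1 ↔ Even N := by
    rw [Chebyshev.T_eval_neg_one]
    rcases Nat.even_or_odd N with hE | hO
    · simp [hE, Int.negOnePow_even N ((Int.even_coe_nat N).2 hE)]
    · rw [Int.negOnePow_odd N ((Int.odd_coe_nat N).2 hO)]
      simp only [Nat.not_even_iff_odd.2 hO, iff_false]
      norm_num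
  set M : Finset ℝ := if Even N then {m₁, m₂} else ∅ with hM
  set FL := J.image fun j => fL (t j) with hFL
  set FR := J.image fun j => fR (t j) with hFR
  have hM_mem : ∀ x ∈ M, l ≤ x ∧ x ≤ r := by
    intro x hx
    rw [hM] at hx
    split_ifs at hx
    · rcases Finset.mem_insert.1 hx with rfl | hx
      · exact ⟨min_le_left _ _, le_max_left _ _⟩
      · rw [Finset.mem_singleton.1 hx]
        exact ⟨min_le_right _ _, le_max_right _ _⟩
    · simp at hx
  have hFL_mem : ∀ x ∈ FL, x ∈ Set.Ioo x₀ l := by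
    intro x hx
    obtain ⟨j, hj, rfl⟩ := Finset.mem_image.1 hx
    exact hfL _ (htJ j hj)
  have hFR_mem : ∀ x ∈ FR, r < x := by
    intro x hx
    obtain ⟨j, hj, rfl⟩ := Finset.mem_image.1 hx
    exact hfR _ (htJ j hj)
  have hsumL : ∑ x ∈ FL, D x = 2 * J.card := by
    rw [hFL, Finset.sum_image]
    · rw [Finset.sum_congr rfl (g := fun _ => 2), Finset.sum_const, smul_eq_mul, mul_comm]
      intro j hj
      have hm := hfL _ (htJ j hj)
      have he : a (fL (t j)) = t j := hfL' _ (htJ j hj)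
      refine hD2 _ (hx₀.trans hm.1) ?_ (.inl ?_)
      · change eval (a (fL (t j))) _ = 1
        rw [he]; exact hT1 j hj
      · change |a (fL (t j))| < 1
        rw [he]; exact abs_lt.2 (htJ j hj)
    · intro i hi j hj hij
      refine htinj hi hj ?_
      have e₁ := hfL' _ (htJ i hi)
      have e₂ := hfL' _ (htJ j hj)
      simp only at hij
      rw [← e₁, ← e₂, hij]
  have hsumR : ∑ x ∈ FR, D x = 2 * J.card := by
    rw [hFR, Finset.sum_image]
    · rw [Finset.sum_congr rfl (g := fun _ => 2), Finset.sum_const, smul_eq_mul, mul_comm]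
      intro j hj
      have hm := hfR _ (htJ j hj)
      have he : a (fR (t j)) = t j := hfR' _ (htJ j hj)
      refine hD2 _ (hr0.trans hm) ?_ (.inl ?_)
      · change eval (a (fR (t j))) _ = 1
        rw [he]; exact hT1 j hj
      · change |a (fR (t j))| < 1
        rw [he]; exact abs_lt.2 (htJ j hj)
    · intro i hi j hj hij
      refine htinj hi hj ?_
      have e₁ := hfR' _ (htJ i hi)
      have e₂ := hfR' _ (htJ j hj)
      simp only at hij
      rw [← e₁, ← e₂, hij]
  have hDx₀ : D x₀ = 1 := by
    refine hD1 x₀ hx₀ ?_ ?_ (.inl hc'x₀)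
    · change eval (a x₀) _ = 1
      rw [hax₀, Chebyshev.T_eval_one]
    · change |a x₀| = 1
      rw [hax₀, abs_one]
  have hsumM : ∑ x ∈ M, D x = if Even N then 2 else 0 := by
    rw [hM]
    split_ifs with hE
    · have hTn := hTneg.2 hE
      rcases eq_or_ne m₁ m₂ with e | e
      · rw [← e, Finset.pair_eq_singleton, Finset.sum_singleton]
        refine hD2 m₁ hm₁ ?_ (.inr ⟨hcm₁, e ▸ hsm₂⟩)
        rw [hcm₁]; simpa using hTn
      · rw [Finset.sum_pair e]
        have hs1 : s' m₁ ≠ 0 := by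
          rcases lt_or_gt_of_ne e with hlt | hlt
          · exact (hsneg m₁ hm₁ hlt).ne
          · exact (hspos m₁ hlt).ne'
        have hc2 : c m₂ ≠ 0 := by
          rcases lt_or_gt_of_ne e with hlt | hlt
          · exact (hcpos m₂ hlt).ne'
          · exact (hcneg m₂ hm₂ hlt).ne
        rw [hD1 m₁ hm₁ (by rw [hcm₁]; simpa using hTn) (by simp [hcm₁]) (.inr (.inr hs1)),
          hD1 m₂ hm₂ (by rw [hsm₂]; simpa using hTn) (by simp [hsm₂]) (.inr (.inl hc2))]
    · simp
  have hsub : {x : ℝ | 0 < x ∧ D x ≠ 0} ⊆ (({x₀} ∪ FL) ∪ (M ∪ FR) : Finset ℝ) := by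
    rintro x ⟨hx, hDx⟩
    have hTx : (Chebyshev.T ℝ N).eval (a x) = 1 := by
      by_contra hne
      exact hDx (hD0 x hx hne)
    have hax : |a x| ≤ 1 := (Chebyshev.abs_eval_T_real_le_one_iff
      (Nat.cast_ne_zero.2 hN0) _).2 (by rw [hTx, abs_one])
    simp only [Finset.coe_union, Set.mem_union, Finset.mem_coe, Finset.mem_singleton]
    rcases lt_trichotomy x x₀ with hlt | rfl | hgt
    · exfalso
      have hd := h.det x hx.le
      have := mul_pos (hc'neg x hx hlt) (h.s_pos x hx)
      have := (abs_le.1 hax).2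
      simp only [ha] at this
      linarith
    · exact .inl (.inl rfl)
    · rcases lt_or_ge x l with hxl | hxl
      · obtain ⟨h1, h2, h3⟩ := hleft x ⟨hgt, hxl⟩
        obtain ⟨j, hj, hxj⟩ := hT2 _ (habs x hx (mul_pos_of_neg_of_neg h1 h2) h3) hTx
        refine .inl (.inr (Finset.mem_image.2 ⟨j, hj, ?_⟩))
        exact hanti (hfL _ (htJ j hj)) ⟨hgt, hxl⟩ ((hfL' _ (htJ j hj)).trans hxj.symm)
      · rcases le_or_gt x r with hxr | hxr
        · refine .inr (.inl ?_)
          have hmem : x = m₁ ∨ x = m₂ := by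
            by_contra hne
            push Not at hne
            have hneg : c x * s' x < 0 := by
              rcases lt_or_gt_of_ne hne.1 with h1 | h1 <;>
                rcases lt_or_gt_of_ne hne.2 with h2 | h2
              · exact absurd (lt_min h1 h2) (not_lt.2 hxl)
              · exact mul_neg_of_neg_of_pos (hcneg x hx h1) (hspos x h2)
              · exact mul_neg_of_pos_of_neg (hcpos x h1) (hsneg x hx h2)
              · exact absurd (max_lt h1 h2) (not_lt.2 hxr)
            have := (abs_le.1 hax).1
            simp only [ha] at this
            linarith
          have hE : Even N := by
            refine hTneg.1 ?_
            have : a x = -1 := by rcases hmem with rfl | rfl <;> simp [ha, hcm₁, hsm₂]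
            rwa [this] at hTx
          rw [hM, if_pos hE]
          simpa using hmem
        · obtain ⟨h1, h2, h3⟩ := hright x hxr
          obtain ⟨j, hj, hxj⟩ := hT2 _ (habs x hx (mul_pos h1 h2) h3) hTx
          refine .inr (.inr (Finset.mem_image.2 ⟨j, hj, ?_⟩))
          exact hmono (hfR _ (htJ j hj)) hxr ((hfR' _ (htJ j hj)).trans hxj.symm)
  have hfin : {x : ℝ | 0 < x ∧ D x ≠ 0}.Finite := (Finset.finite_toSet _).subset hsub
  refine ⟨hfin, ?_⟩
  have hpos : ∀ x ∈ ({x₀} ∪ FL) ∪ (M ∪ FR), 0 < x := by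
    intro x hx
    simp only [Finset.mem_union, Finset.mem_singleton] at hx
    rcases hx with (rfl | hx) | hx | hx
    · exact hx₀
    · exact hx₀.trans (hFL_mem x hx).1
    · exact (hx₀.trans hx₀l).trans_le (hM_mem x hx).1
    · exact hr0.trans (hFR_mem x hx)
  rw [Finset.sum_subset (s₂ := ({x₀} ∪ FL) ∪ (M ∪ FR))
    (fun x hx => by
      have := hsub ((Set.Finite.mem_toFinset _).1 hx)
      exact_mod_cast this)
    (fun x hx hnx => by
      by_contra hne
      exact hnx ((Set.Finite.mem_toFinset _).2 ⟨hpos x hx, hne⟩)),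
    Finset.sum_union, Finset.sum_union, Finset.sum_union, Finset.sum_singleton, hDx₀, hsumL, hsumR,
    hsumM, hJ, Nat.card_Ico]
  · split_ifs with hE
    · obtain ⟨m, hm⟩ := hE
      omega
    · obtain ⟨m, hm⟩ := Nat.not_even_iff_odd.1 hE
      omega
  · rw [Finset.disjoint_left]
    intro x hx hx'
    exact absurd (hFR_mem x hx') (not_lt.2 (hM_mem x hx).2)
  · rw [Finset.disjoint_left]
    intro x hx hx'
    rw [Finset.mem_singleton] at hx
    exact (hFL_mem x hx').1.ne' hx
  · rw [Finset.disjoint_left]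
    intro x hx hx'
    have h1 : x < l := by
      rcases Finset.mem_union.1 hx with hx | hx
      · rw [Finset.mem_singleton.1 hx]; exact hx₀l
      · exact (hFL_mem x hx).2
    rcases Finset.mem_union.1 hx' with hx' | hx'
    · exact absurd (hM_mem x hx').1 (not_le.2 h1)
    · exact absurd ((hFR_mem x hx').trans h1) (not_lt.2 hlr)

end IsHalfPeriodData

namespace IsFundPair

variable {q c c' s s' w w' : ℝ → ℝ} {T : ℝ}

/-- For a potential symmetric about `T`, the fundamental solutions at `2 * T` are determined by
those at `T`. -/
theorem eval_two_mul (h : IsFundPair q c c' s s') (hq : ∀ z, q (2 * T - z) = q z) :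
    c (2 * T) = 2 * (c T * s' T) - 1 ∧ c' (2 * T) = 2 * (c T * c' T) ∧
      s (2 * T) = 2 * (s T * s' T) ∧ s' (2 * T) = 2 * (c T * s' T) - 1 := by
  have hT : 2 * T - T = T := by ring
  have hd := h.det T
  have hc := h.repr (h.solc.comp_const_sub hq) T
  have hs := h.repr (h.sols.comp_const_sub hq) T
  simp only [hT, sub_zero] at hc hs
  obtain ⟨hc₁, hc₂⟩ := hc
  obtain ⟨hs₁, hs₂⟩ := hs
  refine ⟨?_, ?_, ?_, ?_⟩
  · linear_combination (-c (2 * T) - 1) * hd - s' T * hc₁ + s T * hc₂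
  · linear_combination -c' (2 * T) * hd - c' T * hc₁ + c T * hc₂
  · linear_combination -s (2 * T) * hd - s' T * hs₁ + s T * hs₂
  · linear_combination (-s' (2 * T) - 1) * hd - c' T * hs₁ + c T * hs₂

open Polynomial in
/-- The iterates of the monodromy matrix of a symmetric potential. -/
theorem eval_mul_nat (h : IsFundPair q c c' s s') (hq : ∀ z, q (z + T) = q z)
    (hT : s' T = c T) (n : ℕ) :
    c (T * (n + 1)) = (Chebyshev.T ℝ (n + 1)).eval (c T) ∧
    s (T * (n + 1)) = s T * (Chebyshev.U ℝ n).eval (c T) ∧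
    c' (T * (n + 1)) = c' T * (Chebyshev.U ℝ n).eval (c T) ∧
    s' (T * (n + 1)) = (Chebyshev.T ℝ (n + 1)).eval (c T) := by
  have hd := h.det T
  rw [hT] at hd
  have hrec := h.repr (h.solc.comp_add_const hq)
  have hrec' := h.repr (h.sols.comp_add_const hq)
  simp only [zero_add] at hrec hrec'
  induction n with
  | zero => simp [hT]
  | succ n ih =>
    obtain ⟨h₁, h₂, h₃, h₄⟩ := ih
    have hz : T * (((n + 1 : ℕ) : ℝ) + 1) = T * (n + 1) + T := by push_cast; ring
    have hU : (Chebyshev.U ℝ ((n : ℤ) + 1)).eval (c T) =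
        c T * (Chebyshev.U ℝ n).eval (c T) + (Chebyshev.T ℝ (n + 1)).eval (c T) := by
      rw [Chebyshev.U_eq_X_mul_U_add_T]; simp
    have hT₂ : (Chebyshev.T ℝ ((n : ℤ) + 1 + 1)).eval (c T) =
        c T * (Chebyshev.T ℝ (n + 1)).eval (c T) -
          (1 - c T ^ 2) * (Chebyshev.U ℝ n).eval (c T) := by
      have := Chebyshev.T_eq_X_mul_T_sub_pol_U ℝ (n : ℤ)
      rw [add_assoc, show (1:ℤ) + 1 = 2 by norm_num, this]; simp
    rw [hz]
    push_cast
    rw [hU, hT₂, (hrec _).1, (hrec _).2, (hrec' _).1, (hrec' _).2, h₁, h₂, h₃, h₄, hT]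
    refine ⟨?_, ?_, ?_, ?_⟩
    · linear_combination -(Chebyshev.U ℝ n).eval (c T) * hd
    · ring
    · ring
    · linear_combination -(Chebyshev.U ℝ n).eval (c T) * hd

/-- The solution with Cauchy data `α, β` is periodic iff `(α, β)` is fixed by the monodromy. -/
theorem periodic_iff (h : IsFundPair q c c' s s') (hq : ∀ z, q (z + T) = q z) (α β : ℝ) :
    Function.Periodic (fun z => α * c z + β * s z) T ↔
      α * c T + β * s T = α ∧ α * c' T + β * s' T = β := by
  have hw := h.solc.comb h.sols α β
  have hr := h.repr (hw.comp_add_const hq)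
  simp only [zero_add] at hr
  constructor
  · intro hp
    have hp' : ∀ z, α * c' (z + T) + β * s' (z + T) = α * c' z + β * s' z := fun z => by
      have h₁ := (hw.comp_add_const hq z).1
      rw [funext hp] at h₁
      exact h₁.unique (hw z).1
    have h₀ := hp 0
    have h₀' := hp' 0
    simp only [zero_add, h.c_zero, h.c'_zero, h.s_zero, h.s'_zero] at h₀ h₀'
    constructor <;> linarith
  · rintro ⟨h₁, h₂⟩ z
    exact (hr z).1.trans (by rw [h₁, h₂])

end IsFundPair

section FixedSpace

variable {E : Set (ℝ → ℝ)} {Φ : ℝ × ℝ →ₗ[ℝ] ℝ → ℝ} {t x y : ℝ}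

theorem finrank_span_ne_zero_iff (hE : ∀ v, v ∈ E ↔ ∃ α β, α * t + β * x = α ∧
      α * y + β * t = β ∧ v = Φ (α, β)) :
    Module.finrank ℝ (Submodule.span ℝ E) ≠ 0 ↔ ∃ v ∈ E, v ≠ 0 := by
  have hle : Submodule.span ℝ E ≤ LinearMap.range Φ := by
    rw [Submodule.span_le]
    intro v hv
    obtain ⟨α, β, -, -, rfl⟩ := (hE v).1 hv
    exact ⟨_, rfl⟩
  have := Submodule.finiteDimensional_of_le hle
  rw [Ne, Submodule.finrank_eq_zero, Submodule.span_eq_bot]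
  push Not
  rfl

theorem finrank_span_eq_zero (hE : ∀ v, v ∈ E ↔ ∃ α β, α * t + β * x = α ∧
      α * y + β * t = β ∧ v = Φ (α, β)) (hdet : t ^ 2 - x * y = 1) (ht : t ≠ 1) :
    Module.finrank ℝ (Submodule.span ℝ E) = 0 := by
  by_contra hne
  obtain ⟨v, hv, hv0⟩ := (finrank_span_ne_zero_iff hE).1 hne
  obtain ⟨α, β, h₁, h₂, rfl⟩ := (hE v).1 hv
  have hα : (1 - t) * α = 0 := by
    linear_combination -(1 / 2) * α * hdet + (t - 1) / 2 * h₁ - x / 2 * h₂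
  have hβ : (1 - t) * β = 0 := by
    linear_combination -(1 / 2) * β * hdet + (t - 1) / 2 * h₂ - y / 2 * h₁
  have h1t : 1 - t ≠ 0 := sub_ne_zero.2 ht.symm
  rw [(mul_eq_zero.1 hα).resolve_left h1t, (mul_eq_zero.1 hβ).resolve_left h1t] at hv0
  exact hv0 Φ.map_zero

theorem finrank_span_eq_two (hE : ∀ v, v ∈ E ↔ ∃ α β, α * t + β * x = α ∧
      α * y + β * t = β ∧ v = Φ (α, β)) (hΦ : Function.Injective Φ) (ht : t = 1) (hx : x = 0)
    (hy : y = 0) :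
    Module.finrank ℝ (Submodule.span ℝ E) = 2 := by
  have hrange : E = LinearMap.range Φ := by
    ext v
    rw [hE, ht, hx, hy]
    constructor
    · rintro ⟨α, β, -, -, rfl⟩
      exact ⟨_, rfl⟩
    · rintro ⟨⟨α, β⟩, rfl⟩
      exact ⟨α, β, by simp, by simp, rfl⟩
  rw [hrange, Submodule.span_eq, LinearMap.finrank_range_of_inj hΦ]
  simp

theorem finrank_span_eq_one (hE : ∀ v, v ∈ E ↔ ∃ α β, α * t + β * x = α ∧
      α * y + β * t = β ∧ v = Φ (α, β)) (hΦ : Function.Injective Φ) (hdet : t ^ 2 - x * y = 1)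
    (ht : t = 1) (hxy : x ≠ 0 ∨ y ≠ 0) :
    Module.finrank ℝ (Submodule.span ℝ E) = 1 := by
  subst ht
  have h0 : x * y = 0 := by linarith
  obtain ⟨e, he, hspan⟩ : ∃ e : ℝ × ℝ, e ≠ 0 ∧ E = {v | ∃ r : ℝ, v = Φ (r • e)} := by
    rcases hxy with hx | hy
    · have hy : y = 0 := (mul_eq_zero.1 h0).resolve_left hx
      refine ⟨(1, 0), by simp, Set.ext fun v => ?_⟩
      rw [hE]
      constructor
      · rintro ⟨α, β, h₁, -, rfl⟩
        have : β = 0 := (mul_eq_zero.1 (by linarith : β * x = 0)).resolve_right hx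
        exact ⟨α, by simp [this]⟩
      · rintro ⟨r, rfl⟩
        exact ⟨r, 0, by simp, by simp [hy], by simp⟩
    · have hx : x = 0 := (mul_eq_zero.1 h0).resolve_right hy
      refine ⟨(0, 1), by simp, Set.ext fun v => ?_⟩
      rw [hE]
      constructor
      · rintro ⟨α, β, -, h₂, rfl⟩
        have : α = 0 := (mul_eq_zero.1 (by linarith : α * y = 0)).resolve_right hy
        exact ⟨β, by simp [this]⟩
      · rintro ⟨r, rfl⟩
        exact ⟨0, r, by simp [hx], by simp, by simp⟩
  have hE' : E = Submodule.span ℝ {Φ e} := by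
    rw [hspan]
    ext v
    simp [Submodule.mem_span_singleton, eq_comm]
  rw [hE', Submodule.span_eq]
  exact finrank_span_singleton fun h => he (hΦ (h.trans Φ.map_zero.symm))

end FixedSpace

section EigSet

variable {U c c' s s' : ℝ → ℝ} {γ lam : ℝ} {N : ℕ}

theorem mem_EigSetL_iff_exists_isHillSol (hU : ContDiff ℝ (⊤ : ℕ∞) U)
    (hper : Function.Periodic U (2 * π)) (hlt : ∀ z, U z < γ + lam) (v : ℝ → ℝ) :
    v ∈ EigSetL U γ lam N ↔ ∃ w w', IsHillSol (fun z => (γ + lam - U z)⁻¹) w w' ∧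
      Function.Periodic w (2 * π * N) ∧ v = fun z => (γ + lam - U z)⁻¹ * w z := by
  have hp : ∀ z, γ + lam - U z ≠ 0 := fun z => (sub_pos.2 (hlt z)).ne'
  have hUN : Function.Periodic U (2 * π * N) := by
    rw [mul_comm]; exact hper.nat_mul N
  have hq : ContDiff ℝ (⊤ : ℕ∞) fun z => (γ + lam - U z)⁻¹ := (contDiff_const.sub hU).inv hp
  constructor
  · rintro ⟨hv, hvper, -, heq⟩
    set f : ℝ → ℝ := fun w => (U w - γ - lam) * v w with hf
    have hfs : ContDiff ℝ (⊤ : ℕ∞) f := ((hU.sub contDiff_const).sub contDiff_const).mul hv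
    have hf' : ContDiff ℝ (⊤ : ℕ∞) (deriv f) := hfs.iterate_deriv 1
    have hfv : ∀ z, deriv (deriv f) z = v z := fun z => by
      rw [← heq z, iteratedDeriv_succ, iteratedDeriv_one]
    have hqf : ∀ z, (γ + lam - U z)⁻¹ * -f z = v z := fun z => by
      rw [inv_mul_eq_div, div_eq_iff (hp z)]; simp only [hf]; ring
    refine ⟨fun z => -f z, fun z => -deriv f z, fun z => ⟨?_, ?_⟩, fun z => ?_, ?_⟩
    · exact (hfs.differentiable (by simp) z).hasDerivAt.neg
    · rw [hqf, ← hfv]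
      exact (hf'.differentiable (by simp) z).hasDerivAt.neg
    · simp only [hf, hvper z, hUN z]
    · exact (funext hqf).symm
  · rintro ⟨w, w', hw, hwper, rfl⟩
    have hs := hw.contDiff hq
    have hw'per : ∀ z, w' (z + 2 * π * N) = w' z := fun z => by
      have h₁ := (hw (z + 2 * π * N)).1.comp_add_const z (2 * π * N)
      rw [funext hwper] at h₁
      exact h₁.unique (hw z).1
    refine ⟨hq.mul hs.1, fun z => ?_, ?_, fun z => ?_⟩
    · simp only [hUN z, hwper z]
    · have hval := intervalIntegral.integral_eq_sub_of_hasDerivAt (a := 0) (b := 2 * π * N)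
        (fun z _ => (hw z).2.neg)
        ((Continuous.neg (hq.continuous.mul hw.continuous).neg).intervalIntegrable _ _)
      simp only [neg_neg] at hval
      rw [hval]
      have := hw'per 0
      rw [zero_add] at this
      simp [this]
    · have h₁ : (fun x => (U x - γ - lam) * ((γ + lam - U x)⁻¹ * w x)) = fun x => -w x := by
        funext x
        have := hp x
        field_simp
        ring
      have h₂ : deriv (fun x => -w x) = fun x => -w' x := funext fun x => (hw x).1.neg.deriv
      rw [h₁, iteratedDeriv_succ, iteratedDeriv_one, h₂]
      exact (hw z).2.neg.deriv.trans (neg_neg _)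

/-- The eigenfunctions, parametrized by Cauchy data fixed by the monodromy matrix. -/
theorem mem_EigSetL_iff (hU : ContDiff ℝ (⊤ : ℕ∞) U)
    (hper : Function.Periodic U (2 * π)) (hlt : ∀ z, U z < γ + lam)
    (h : IsFundPair (fun z => (γ + lam - U z)⁻¹) c c' s s') (v : ℝ → ℝ) :
    v ∈ EigSetL U γ lam N ↔ ∃ α β,
      α * c (2 * π * N) + β * s (2 * π * N) = α ∧ α * c' (2 * π * N) + β * s' (2 * π * N) = β ∧
      v = fun z => (γ + lam - U z)⁻¹ * (α * c z + β * s z) := by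
  have hUN : Function.Periodic U (2 * π * N) := by
    rw [mul_comm]; exact hper.nat_mul N
  have hqN : ∀ z, (γ + lam - U (z + 2 * π * N))⁻¹ = (γ + lam - U z)⁻¹ := fun z => by rw [hUN z]
  rw [mem_EigSetL_iff_exists_isHillSol hU hper hlt]
  constructor
  · rintro ⟨w, w', hw, hwper, rfl⟩
    have hr : w = fun z => w 0 * c z + w' 0 * s z := funext fun z => (h.repr hw z).1
    have := (h.periodic_iff hqN (w 0) (w' 0)).1 (hr ▸ hwper)
    refine ⟨w 0, w' 0, this.1, this.2, ?_⟩
    funext z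
    rw [← (h.repr hw z).1]
  · rintro ⟨α, β, h₁, h₂, rfl⟩
    exact ⟨_, _, h.solc.comb h.sols α β, (h.periodic_iff hqN α β).2 ⟨h₁, h₂⟩, rfl⟩

/-- The linear parametrization of solutions by Cauchy data. -/
noncomputable def cauchyMap (q c s : ℝ → ℝ) : ℝ × ℝ →ₗ[ℝ] ℝ → ℝ where
  toFun e := fun z => q z * (e.1 * c z + e.2 * s z)
  map_add' e₁ e₂ := by
    funext z
    simp only [Prod.fst_add, Prod.snd_add, Pi.add_apply]
    ring
  map_smul' r e := by
    funext z
    simp only [Prod.smul_fst, Prod.smul_snd, Pi.smul_apply, smul_eq_mul, RingHom.id_apply]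
    ring

theorem cauchyMap_injective {q : ℝ → ℝ} (h : IsFundPair q c c' s s') (hq : ∀ z, q z ≠ 0) :
    Function.Injective (cauchyMap q c s) := by
  rw [injective_iff_map_eq_zero]
  rintro ⟨α, β⟩ he
  have hw := h.solc.comb h.sols α β
  have h0 : (fun z => α * c z + β * s z) = fun _ => 0 := by
    funext z
    exact (mul_eq_zero.1 (congrFun he z)).resolve_left (hq z)
  have h₁ := (hw 0).1
  rw [h0] at h₁
  have h₂ := h₁.unique (hasDerivAt_const 0 (0:ℝ))
  have h₃ := congrFun h0 0
  simp only [h.c_zero, h.c'_zero, h.s_zero, h.s'_zero] at h₂ h₃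
  ext <;> simp <;> linarith

variable (N) in
open Polynomial in
/-- The dimension of the eigenspace in terms of the fundamental solutions at the half period. -/
theorem finrank_EigSetL (hN : 1 ≤ N) (hU : ContDiff ℝ (⊤ : ℕ∞) U) (heven : ∀ z, U (-z) = U z)
    (hper : Function.Periodic U (2 * π)) (hlt : ∀ z, U z < γ + lam)
    (h : IsFundPair (fun z => (γ + lam - U z)⁻¹) c c' s s') (hs : 0 < s π) :
    (Module.finrank ℝ (Submodule.span ℝ (EigSetL U γ lam N)) ≠ 0 ↔
      ∃ v ∈ EigSetL U γ lam N, v ≠ 0) ∧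
    ((Chebyshev.T ℝ N).eval (2 * (c π * s' π) - 1) ≠ 1 →
      Module.finrank ℝ (Submodule.span ℝ (EigSetL U γ lam N)) = 0) ∧
    ((Chebyshev.T ℝ N).eval (2 * (c π * s' π) - 1) = 1 →
      |2 * (c π * s' π) - 1| < 1 ∨ (c π = 0 ∧ s' π = 0) →
      Module.finrank ℝ (Submodule.span ℝ (EigSetL U γ lam N)) = 2) ∧
    ((Chebyshev.T ℝ N).eval (2 * (c π * s' π) - 1) = 1 → |2 * (c π * s' π) - 1| = 1 →
      (c' π = 0 ∨ c π ≠ 0 ∨ s' π ≠ 0) →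
      Module.finrank ℝ (Submodule.span ℝ (EigSetL U γ lam N)) = 1) := by
  obtain ⟨n, rfl⟩ := Nat.exists_eq_add_of_le' hN
  have hper' : ∀ z, (γ + lam - U (z + 2 * π))⁻¹ = (γ + lam - U z)⁻¹ := fun z => by rw [hper z]
  have hsymm : ∀ z, (γ + lam - U (2 * π - z))⁻¹ = (γ + lam - U z)⁻¹ := fun z => by
    rw [show 2 * π - z = -z + 2 * π by ring, hper, heven]
  obtain ⟨m₁, m₂, m₃, m₄⟩ := h.eval_two_mul hsymm
  obtain ⟨i₁, i₂, i₃, i₄⟩ := h.eval_mul_nat hper' (m₄.trans m₁.symm) n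
  have hdet := h.det (2 * π * (n + 1))
  have hdetπ := h.det π
  rw [m₁] at i₁ i₂ i₃ i₄
  set a := 2 * (c π * s' π) - 1 with ha
  have hpell : (Chebyshev.T ℝ (n + 1)).eval a ^ 2 -
      (a ^ 2 - 1) * (Chebyshev.U ℝ n).eval a ^ 2 = 1 := by
    rw [i₁, i₂, i₃, i₄, m₂, m₃] at hdet
    rw [ha] at hdet ⊢
    linear_combination hdet - 4 * (c π * s' π) * (Chebyshev.U ℝ n).eval
      (2 * (c π * s' π) - 1) ^ 2 * hdetπ
  have hE := mem_EigSetL_iff (N := n + 1) hU hper hlt h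
  push_cast at hE ⊢
  rw [i₁, i₄] at hE hdet
  have hE' : ∀ v, v ∈ EigSetL U γ lam (n + 1) ↔ ∃ α β,
      α * (Chebyshev.T ℝ (n + 1)).eval a + β * s (2 * π * (n + 1)) = α ∧
      α * c' (2 * π * (n + 1)) + β * (Chebyshev.T ℝ (n + 1)).eval a = β ∧
      v = cauchyMap (fun z => (γ + lam - U z)⁻¹) c s (α, β) := hE
  have hinj := cauchyMap_injective h fun z => (inv_pos.2 (sub_pos.2 (hlt z))).ne'
  refine ⟨finrank_span_ne_zero_iff hE', fun ht => finrank_span_eq_zero hE' (by linarith) ht,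
    fun ht ha' => ?_, fun ht ha' hne => ?_⟩
  · rw [ht] at hpell
    have hu : |a| < 1 → (Chebyshev.U ℝ n).eval a = 0 := fun ha' => by
      have h₁ : (1 - a ^ 2) * (Chebyshev.U ℝ n).eval a ^ 2 = 0 := by linarith
      have h₂ := sq_lt_one_iff_abs_lt_one a |>.2 ha'
      exact pow_eq_zero_iff two_ne_zero |>.1 ((mul_eq_zero.1 h₁).resolve_left (by linarith))
    refine finrank_span_eq_two hE' hinj ht ?_ ?_
    · rcases ha' with ha' | ⟨-, hs'⟩
      · rw [i₂, hu ha', mul_zero]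
      · rw [i₂, m₃, hs']; simp
    · rcases ha' with ha' | ⟨hc, -⟩
      · rw [i₃, hu ha', mul_zero]
      · rw [i₃, m₂, hc]; simp
  · have hu : (Chebyshev.U ℝ n).eval a ≠ 0 := by
      have hn : (n:ℝ) + 1 ≠ 0 := by positivity
      rcases eq_or_eq_neg_of_abs_eq ha' with h1 | h1
      · rw [h1, Chebyshev.U_eval_one]
        simpa using hn
      · rw [h1, Chebyshev.U_eval_neg_one]
        simpa using hn
    refine finrank_span_eq_one hE' hinj (by linarith) ht ?_
    rw [i₂, i₃, m₂, m₃]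
    by_cases hs' : s' π = 0
    · right
      have hcs : c' π * s π = -1 := by rw [hs'] at hdetπ; linarith
      have hc' : c' π ≠ 0 := by rintro h0; rw [h0] at hcs; norm_num at hcs
      have hc : c π ≠ 0 := by
        rcases hne with h0 | h0 | h0
        · exact absurd h0 hc'
        · exact h0
        · exact absurd hs' h0
      simp [hc, hc', hu]
    · left
      simp [hs.ne', hs', hu]

end EigSet

/-- An even nonconstant `2π`-periodic wave profile of the reduced Ostrovsky equation, small
compared with `γ`. -/
structure IsOstrovskyWave (U : ℝ → ℝ) (γ : ℝ) : Prop where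
  even : ∀ z, U (-z) = U z
  contDiff : ContDiff ℝ (⊤ : ℕ∞) U
  nonconst : ∃ z w, U z ≠ U w
  periodic : Function.Periodic U (2 * π)
  ode : ∀ z, deriv (fun w => (γ - U w) * deriv U w) z + U z = 0
  pos : 0 < γ
  gap : ∀ z, 1 / 4 < γ - U z

namespace IsOstrovskyWave

variable {U c c' s s' : ℝ → ℝ} {γ : ℝ}

theorem sub_pos (hU : IsOstrovskyWave U γ) (z : ℝ) : 0 < γ - U z :=
  lt_trans (by norm_num) (hU.gap z)

theorem hasDerivAt (hU : IsOstrovskyWave U γ) (z : ℝ) : HasDerivAt U (deriv U z) z :=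
  (hU.contDiff.differentiable (by simp) z).hasDerivAt

/-- The derivative of the wave gives a solution of Hill's equation at `λ = 0`. -/
theorem isHillSol (hU : IsOstrovskyWave U γ) :
    IsHillSol (fun z => (γ - U z)⁻¹) (fun z => (γ - U z) * deriv U z) (fun z => -U z) := by
  have hU' : ContDiff ℝ (⊤ : ℕ∞) (deriv U) := hU.contDiff.iterate_deriv 1
  refine fun z => ⟨?_, ?_⟩
  · have := (((contDiff_const (c := γ)).sub hU.contDiff).mul hU').differentiable (by simp) z
    have h := this.hasDerivAt
    have hode : deriv (fun w => (γ - U w) * deriv U w) z = -U z := by linarith [hU.ode z]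
    rwa [hode] at h
  · refine (hU.hasDerivAt z).neg.congr_deriv ?_
    rw [inv_mul_cancel_left₀ (hU.sub_pos z).ne']

theorem deriv_neg (hU : IsOstrovskyWave U γ) (z : ℝ) : deriv U (-z) = -deriv U z := by
  have h := (hU.hasDerivAt (-z)).comp z (hasDerivAt_neg z)
  have h' : U ∘ Neg.neg = U := funext hU.even
  rw [h'] at h
  linarith [h.unique (hU.hasDerivAt z)]

theorem deriv_periodic (hU : IsOstrovskyWave U γ) : Function.Periodic (deriv U) (2 * π) := by
  intro z
  have h := (hU.hasDerivAt (z + 2 * π)).comp_add_const z (2 * π)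
  rw [funext hU.periodic] at h
  exact h.unique (hU.hasDerivAt z)

theorem deriv_zero (hU : IsOstrovskyWave U γ) : deriv U 0 = 0 := by
  have := hU.deriv_neg 0
  rw [neg_zero] at this
  linarith

theorem deriv_pi (hU : IsOstrovskyWave U γ) : deriv U π = 0 := by
  have h₁ := hU.deriv_neg π
  have h₂ := hU.deriv_periodic (-π)
  rw [show -π + 2 * π = π by ring] at h₂
  linarith

theorem deriv_two_pi_mul (hU : IsOstrovskyWave U γ) (N : ℕ) : deriv U (2 * π * N) = 0 := by
  rw [mul_comm, hU.deriv_periodic.nat_mul_eq, hU.deriv_zero]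

theorem eq_of_isFundPair (hU : IsOstrovskyWave U γ)
    (h : IsFundPair (fun z => (γ - U z)⁻¹) c c' s s') (z : ℝ) :
    (γ - U z) * deriv U z = -U 0 * s z ∧ U z = U 0 * s' z := by
  have := h.repr hU.isHillSol z
  simp only [hU.deriv_zero, mul_zero, zero_mul, zero_add] at this
  exact ⟨this.1, by linarith [this.2]⟩

theorem apply_zero_ne (hU : IsOstrovskyWave U γ)
    (h : IsFundPair (fun z => (γ - U z)⁻¹) c c' s s') : U 0 ≠ 0 := by
  intro h0
  obtain ⟨z, w, hne⟩ := hU.nonconst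
  rw [(hU.eq_of_isFundPair h z).2, (hU.eq_of_isFundPair h w).2, h0, zero_mul, zero_mul] at hne
  exact hne rfl

theorem s_eq_zero (hU : IsOstrovskyWave U γ)
    (h : IsFundPair (fun z => (γ - U z)⁻¹) c c' s s') {z : ℝ} (hz : deriv U z = 0) :
    s z = 0 := by
  have := (hU.eq_of_isFundPair h z).1
  rw [hz, mul_zero] at this
  have := mul_eq_zero.1 this.symm
  exact this.resolve_left (neg_ne_zero.2 (hU.apply_zero_ne h))

theorem isHillSol_sin :
    IsHillSol (fun _ => 4) (fun z => sin (2 * z)) (fun z => 2 * cos (2 * z)) := by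
  intro z
  have h : HasDerivAt (fun z : ℝ => 2 * z) 2 z := by simpa using (hasDerivAt_id z).const_mul 2
  exact ⟨h.sin.congr_deriv (by ring), (h.cos.const_mul 2).congr_deriv (by ring)⟩

/-- Two consecutive zeros of a solution are more than `π / 2` apart. -/
theorem pos_of_lt_four {q w w' : ℝ → ℝ} (h : IsHillSol q w w') (hq : ∀ z, q z < 4)
    (h0 : w 0 = 0) (h0' : 0 < w' 0) : ∀ z ∈ Set.Ioc 0 (π / 2), 0 < w z :=
  isHillSol_sin.pos_of_sturm h hq (by simp [h0]) ((h 0).1.eventually_pos_right h0 h0')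
    fun z hz => sin_pos_of_pos_of_lt_pi (by linarith [hz.1]) (by linarith [hz.2])

theorem inv_lt_four (hU : IsOstrovskyWave U γ) (z : ℝ) : (γ - U z)⁻¹ < 4 :=
  inv_lt_of_inv_lt₀ (by norm_num) (by linarith [hU.gap z])

theorem s_pos (hU : IsOstrovskyWave U γ)
    (h : IsFundPair (fun z => (γ - U z)⁻¹) c c' s s') :
    s' π < 0 ∧ ∀ z ∈ Set.Ioo 0 π, 0 < s z := by
  have hsπ := hU.s_eq_zero h hU.deriv_pi
  have hs' : s' π ≠ 0 := by
    have := h.det π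
    rintro h0
    rw [hsπ, h0] at this
    norm_num at this
  have hleft := pos_of_lt_four h.sols hU.inv_lt_four h.s_zero (by simp [h.s'_zero])
  have hrefl : ∀ r : ℝ, IsHillSol (fun z => (γ - U (π - z))⁻¹) (fun z => r * s (π - z))
      (fun z => r * -s' (π - z)) := fun r z =>
    ⟨((h.sols (π - z)).1.comp_const_sub π z).const_mul r,
      (((h.sols (π - z)).2.comp_const_sub π z).neg.const_mul r).congr_deriv (by ring)⟩
  have hright : ∀ r, 0 < r * -s' π → ∀ z ∈ Set.Ioc 0 (π / 2), 0 < r * s (π - z) := fun r hr =>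
    pos_of_lt_four (hrefl r) (fun z => hU.inv_lt_four _) (by simp [hsπ]) (by simpa using hr)
  have hmem : π / 2 ∈ Set.Ioc 0 (π / 2) := ⟨by positivity, le_rfl⟩
  have hneg : s' π < 0 := by
    refine lt_of_le_of_ne (not_lt.1 fun hpos => ?_) hs'
    have h₁ := hright (-1) (by linarith) _ hmem
    have h₂ := hleft _ hmem
    rw [sub_half] at h₁
    linarith
  refine ⟨hneg, fun z hz => ?_⟩
  rcases le_or_gt z (π / 2) with hz' | hz'
  · exact hleft z ⟨hz.1, hz'⟩
  · have := hright 1 (by linarith) (π - z) ⟨by linarith [hz.2], by linarith⟩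
    simpa using this

theorem c_neg (hU : IsOstrovskyWave U γ)
    (h : IsFundPair (fun z => (γ - U z)⁻¹) c c' s s') : c π < 0 := by
  have hdet := h.det π
  rw [hU.s_eq_zero h hU.deriv_pi] at hdet
  have := (hU.s_pos h).1
  by_contra hc
  nlinarith

theorem continuous_div (hU : IsOstrovskyWave U γ) : Continuous fun z => U z / (γ - U z) :=
  hU.contDiff.continuous.div (continuous_const.sub hU.contDiff.continuous)
    fun z => (hU.sub_pos z).ne'

/-- The second solution at `λ = 0`, in closed form. -/
theorem isHillSol_second (hU : IsOstrovskyWave U γ) :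
    IsHillSol (fun z => (γ - U z)⁻¹)
      (fun z => γ * U z - 2 / 3 * U z ^ 2 +
        1 / 3 * ((γ - U z) * deriv U z * ∫ x in (0:ℝ)..z, U x / (γ - U x)))
      (fun z => (γ - U z) * deriv U z - 1 / 3 * (U z * ∫ x in (0:ℝ)..z, U x / (γ - U x))) := by
  intro z
  have hI : HasDerivAt (fun z => ∫ x in (0:ℝ)..z, U x / (γ - U x)) (U z / (γ - U z)) z :=
    hU.continuous_div.integral_hasStrictDerivAt 0 z |>.hasDerivAt
  have hz := (hU.sub_pos z).ne'
  have hd := hU.hasDerivAt z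
  have hw := (hU.isHillSol z).1
  constructor
  · refine (((hd.const_mul γ).sub ((hd.pow 2).const_mul (2 / 3))).add
      ((hw.mul hI).const_mul (1 / 3))).congr_deriv ?_
    field_simp
    ring
  · refine (hw.sub ((hd.mul hI).const_mul (1 / 3))).congr_deriv ?_
    field_simp
    ring

theorem integral_pos (hU : IsOstrovskyWave U γ) (h0 : U 0 ≠ 0) {z : ℝ} (hz : 0 < z)
    (hz' : deriv U z = 0) : 0 < ∫ x in (0:ℝ)..z, U x / (γ - U x) := by
  have hcont := hU.contDiff.continuous
  have hsum : γ * (∫ x in (0:ℝ)..z, U x / (γ - U x)) =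
      (∫ x in (0:ℝ)..z, U x) + ∫ x in (0:ℝ)..z, U x ^ 2 / (γ - U x) := by
    rw [← intervalIntegral.integral_const_mul, ← intervalIntegral.integral_add
      (hcont.intervalIntegrable _ _)]
    · refine intervalIntegral.integral_congr fun x _ => ?_
      have := (hU.sub_pos x).ne'
      field_simp
      ring
    · exact ((hcont.pow 2).div (continuous_const.sub hcont)
        fun z => (hU.sub_pos z).ne').intervalIntegrable _ _
  have hzero : ∫ x in (0:ℝ)..z, U x = 0 := by
    have := intervalIntegral.integral_eq_sub_of_hasDerivAt (a := 0) (b := z)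
      (fun x _ => (hU.isHillSol x).1) (hcont.neg.intervalIntegrable _ _)
    rw [intervalIntegral.integral_neg, hz', hU.deriv_zero] at this
    linarith
  have hpos : 0 < ∫ x in (0:ℝ)..z, U x ^ 2 / (γ - U x) := by
    refine intervalIntegral.integral_pos hz ?_
      (fun x _ => div_nonneg (sq_nonneg _) (hU.sub_pos x).le)
      ⟨0, ⟨le_rfl, hz.le⟩, div_pos (by positivity) (hU.sub_pos 0)⟩
    exact ((hcont.pow 2).div (continuous_const.sub hcont)
      fun z => (hU.sub_pos z).ne').continuousOn
  have := hU.pos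
  by_contra hneg
  nlinarith

theorem c'_mul_s'_neg (hU : IsOstrovskyWave U γ)
    (h : IsFundPair (fun z => (γ - U z)⁻¹) c c' s s') {z : ℝ} (hz : 0 < z)
    (hz' : deriv U z = 0) (hs : s' z ≠ 0) : c' z * s' z < 0 := by
  have h0 := hU.apply_zero_ne h
  have hI := hU.integral_pos h0 hz hz'
  have hr := (h.repr hU.isHillSol_second z).2
  simp only [hU.deriv_zero, hz', mul_zero, zero_mul, intervalIntegral.integral_same, add_zero,
    sub_zero, zero_sub] at hr
  rw [(hU.eq_of_isFundPair h z).2] at hr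
  have hr' : U 0 * ((γ - 2 / 3 * U 0) * c' z) =
      U 0 * (-(1 / 3 * (s' z * ∫ x in (0:ℝ)..z, U x / (γ - U x)))) := by linarith
  have hr'' := mul_left_cancel₀ h0 hr'
  have hγ : 0 < γ - 2 / 3 * U 0 := by
    have := hU.sub_pos 0
    have := hU.pos
    rcases le_total (U 0) 0 with _ | _ <;> linarith
  have : (γ - 2 / 3 * U 0) * (c' z * s' z) < 0 := by
    have h₁ : 0 < s' z ^ 2 := by positivity
    have h₂ := mul_pos h₁ hI
    calc (γ - 2 / 3 * U 0) * (c' z * s' z) = ((γ - 2 / 3 * U 0) * c' z) * s' z := by ring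
      _ < 0 := by rw [hr'']; linarith
  exact (pos_iff_neg_of_mul_neg this).1 hγ

end IsOstrovskyWave

namespace IsOstrovskyWave

variable {U : ℝ → ℝ} {γ : ℝ}

theorem deriv_ne_zero (hU : IsOstrovskyWave U γ) : deriv U ≠ 0 := by
  intro h
  obtain ⟨z, w, hne⟩ := hU.nonconst
  exact hne (is_const_of_deriv_eq_zero (hU.contDiff.differentiable (by simp)) (congrFun h) z w)

theorem inv_le (hU : IsOstrovskyWave U γ) {lam : ℝ} (hl : 0 ≤ lam) (z : ℝ) :
    (γ + lam - U z)⁻¹ ≤ 4 :=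
  inv_le_of_inv_le₀ (by norm_num) (by linarith [hU.gap z])

theorem potential_pos (hU : IsOstrovskyWave U γ) {lam : ℝ} (hl : 0 ≤ lam) (z : ℝ) :
    0 < (γ + lam - U z)⁻¹ :=
  inv_pos.2 (by linarith [hU.sub_pos z])

theorem abs_inv_le (hU : IsOstrovskyWave U γ) {lam : ℝ} (hl : 0 ≤ lam) (z : ℝ) :
    |(γ + lam - U z)⁻¹| ≤ 4 := by
  rw [abs_of_pos (hU.potential_pos hl z)]
  exact hU.inv_le hl z

theorem continuous_inv (hU : IsOstrovskyWave U γ) {lam : ℝ} (hl : 0 ≤ lam) :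
    Continuous fun z => (γ + lam - U z)⁻¹ :=
  (continuous_const.sub hU.contDiff.continuous).inv₀
    fun z => (inv_pos.1 (hU.potential_pos hl z)).ne'

theorem exists_isFundPair (hU : IsOstrovskyWave U γ) {lam : ℝ} (hl : 0 ≤ lam) :
    ∃ c c' s s', IsFundPair (fun z => (γ + lam - U z)⁻¹) c c' s s' := by
  obtain ⟨c, c', hc, hc0, hc0'⟩ := exists_isHillSol (hU.continuous_inv hl) (hU.abs_inv_le hl) 1 0
  obtain ⟨s, s', hs, hs0, hs0'⟩ := exists_isHillSol (hU.continuous_inv hl) (hU.abs_inv_le hl) 0 1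
  exact ⟨c, c', s, s', hc, hs, hc0, hc0', hs0, hs0'⟩

/-- The kernel of the Hessian operator is spanned by the derivative of the wave. -/
theorem EigSetL_zero (hU : IsOstrovskyWave U γ) {N : ℕ} (hN : 1 ≤ N) :
    EigSetL U γ 0 N = {v | ∃ r : ℝ, v = fun z => r * deriv U z} := by
  obtain ⟨c, c', s, s', h⟩ := hU.exists_isFundPair le_rfl
  have hlt : ∀ z, U z < γ + 0 := fun z => by linarith [hU.sub_pos z]
  have hz' := hU.deriv_two_pi_mul N
  have hP : (0:ℝ) < 2 * π * N := by
    have : (0:ℝ) < N := by exact_mod_cast hN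
    positivity
  have hPer : U (2 * π * N) = U 0 := by rw [mul_comm, hU.periodic.nat_mul_eq]
  ext v
  constructor
  · rw [mem_EigSetL_iff hU.contDiff hU.periodic hlt h]
    simp only [add_zero] at h ⊢
    have h0 := hU.apply_zero_ne h
    have hs' : s' (2 * π * N) = 1 := by
      have := (hU.eq_of_isFundPair h (2 * π * N)).2
      rw [hPer] at this
      exact mul_left_cancel₀ h0 (by linarith)
    have hc' := hU.c'_mul_s'_neg h hP hz' (by rw [hs']; exact one_ne_zero)
    rintro ⟨α, β, -, h₂, rfl⟩
    rw [hs', mul_one] at hc' h₂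
    have hα : α = 0 := by
      rcases mul_eq_zero.1 (by linarith : α * c' (2 * π * N) = 0) with h | h
      · exact h
      · exact absurd h hc'.ne
    refine ⟨-β / U 0, funext fun z => ?_⟩
    have hz := (hU.sub_pos z).ne'
    have := (hU.eq_of_isFundPair h z).1
    rw [hα]
    field_simp
    linear_combination β * this
  · rw [mem_EigSetL_iff_exists_isHillSol hU.contDiff hU.periodic hlt]
    simp only [add_zero] at h ⊢
    rintro ⟨r, rfl⟩
    have hw := hU.isHillSol.comb hU.isHillSol r 0
    refine ⟨_, _, hw, fun z => ?_, funext fun z => ?_⟩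
    · have h₁ := hU.periodic.nat_mul N z
      have h₂ := hU.deriv_periodic.nat_mul N z
      rw [mul_comm] at h₁ h₂
      simp only [h₁, h₂]
    · have hz := (hU.sub_pos z).ne'
      field_simp
      ring

theorem inv_sub_inv_le (hU : IsOstrovskyWave U γ) {lam μ : ℝ} (hl : 0 ≤ lam) (hμ : 0 ≤ μ)
    (z : ℝ) : |(γ + lam - U z)⁻¹ - (γ + μ - U z)⁻¹| ≤ 16 * |lam - μ| := by
  have h₁ := hU.potential_pos hl z
  have h₂ := hU.potential_pos hμ z
  rw [inv_sub_inv (inv_pos.1 h₁).ne' (inv_pos.1 h₂).ne', div_eq_mul_inv, mul_inv,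
    abs_mul, abs_of_pos (mul_pos h₁ h₂), mul_comm]
  have h₃ : γ + μ - U z - (γ + lam - U z) = -(lam - μ) := by ring
  rw [h₃, abs_neg]
  have := mul_le_mul (hU.inv_le hl z) (hU.inv_le hμ z) h₂.le (by norm_num)
  exact mul_le_mul_of_nonneg_right (by linarith) (abs_nonneg _)

theorem inv_lt_inv_param (hU : IsOstrovskyWave U γ) {lam μ : ℝ} (hl : 0 ≤ lam) (h : lam < μ)
    (z : ℝ) : (γ + μ - U z)⁻¹ < (γ + lam - U z)⁻¹ :=
  inv_strictAnti₀ (inv_pos.1 (hU.potential_pos hl z)) (by linarith)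

theorem inv_le_inv_param (hU : IsOstrovskyWave U γ) {lam : ℝ} (hl : 0 < lam)
    (z : ℝ) : |(γ + lam - U z)⁻¹ - 0| ≤ lam⁻¹ := by
  rw [sub_zero, abs_of_pos (hU.potential_pos hl.le z)]
  exact inv_anti₀ hl (by linarith [hU.sub_pos z])

open Filter Topology in
/-- Solutions with prescribed Cauchy data depend continuously on the spectral parameter and
converge to the free solution at infinity. -/
theorem continuousOn_and_tendsto (hU : IsOstrovskyWave U γ) {W W' : ℝ → ℝ → ℝ} {α β T : ℝ}
    (hT : 0 ≤ T)
    (hW : ∀ lam, 0 ≤ lam → IsHillSol (fun z => (γ + lam - U z)⁻¹) (W lam) (W' lam) ∧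
      W lam 0 = α ∧ W' lam 0 = β) :
    ContinuousOn (fun lam => W lam T) (Set.Ici 0) ∧
    ContinuousOn (fun lam => W' lam T) (Set.Ici 0) ∧
    Tendsto (fun lam => W lam T) atTop (𝓝 (α + β * T)) ∧
    Tendsto (fun lam => W' lam T) atTop (𝓝 β) := by
  have hcont : ∀ μ, 0 ≤ μ → ∃ M, ∀ lam, 0 ≤ lam →
      |W lam T - W μ T| ≤ |lam - μ| * M ∧ |W' lam T - W' μ T| ≤ |lam - μ| * M := by
    intro μ hμ
    obtain ⟨B, hB⟩ := (isCompact_Icc (a := (0:ℝ)) (b := T)).exists_bound_of_continuousOn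
      (hW μ hμ).1.continuous.continuousOn
    refine ⟨16 * (B * exp (4 * T)), fun lam hl => ?_⟩
    have := (hW lam hl).1.abs_sub_le (hW μ hμ).1 (by rw [(hW lam hl).2.1, (hW μ hμ).2.1])
      (by rw [(hW lam hl).2.2, (hW μ hμ).2.2]) (K := 4) (δ := 16 * |lam - μ|) (B := B) hT
      (by norm_num) (by positivity) (hU.abs_inv_le hl) (hU.inv_sub_inv_le hl hμ) hB
    constructor <;> linarith [this.1, this.2]
  have hcont' : ∀ f : ℝ → ℝ, (∀ μ, 0 ≤ μ → ∃ M, ∀ lam, 0 ≤ lam → |f lam - f μ| ≤ |lam - μ| * M) →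
      ContinuousOn f (Set.Ici 0) := by
    intro f hf μ hμ
    obtain ⟨M, hM⟩ := hf μ hμ
    have ht : Tendsto (fun lam => |lam - μ| * M) (𝓝[Set.Ici 0] μ) (𝓝 0) := by
      have : Continuous fun lam : ℝ => |lam - μ| * M := by fun_prop
      have h := this.tendsto μ
      simp only [sub_self, abs_zero, zero_mul] at h
      exact h.mono_left nhdsWithin_le_nhds
    refine tendsto_iff_norm_sub_tendsto_zero.2 (squeeze_zero' (.of_forall fun _ => norm_nonneg _)
      ?_ ht)
    filter_upwards [self_mem_nhdsWithin] with lam hl using hM lam hl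
  have hfree : IsHillSol (fun _ => 0) (fun z => α + β * z) fun _ => β := fun z =>
    ⟨by simpa using ((hasDerivAt_id z).const_mul β).const_add α,
      by simpa using hasDerivAt_const z β⟩
  obtain ⟨B, hB⟩ := (isCompact_Icc (a := (0:ℝ)) (b := T)).exists_bound_of_continuousOn
    hfree.continuous.continuousOn
  have hlim : ∀ lam, 0 < lam → |W lam T - (α + β * T)| ≤ lam⁻¹ * (B * exp (4 * T)) ∧
      |W' lam T - β| ≤ lam⁻¹ * (B * exp (4 * T)) := fun lam hl =>
    (hW lam hl.le).1.abs_sub_le hfree (by simp [(hW lam hl.le).2.1]) (hW lam hl.le).2.2 hT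
      (by norm_num) (by positivity) (hU.abs_inv_le hl.le) (hU.inv_le_inv_param hl) hB
  have hz : Tendsto (fun lam : ℝ => lam⁻¹ * (B * exp (4 * T))) atTop (𝓝 0) := by
    simpa using tendsto_inv_atTop_zero.mul_const (B * exp (4 * T))
  refine ⟨hcont' _ fun μ hμ => ?_, hcont' _ fun μ hμ => ?_, ?_, ?_⟩
  · obtain ⟨M, hM⟩ := hcont μ hμ
    exact ⟨M, fun lam hl => (hM lam hl).1⟩
  · obtain ⟨M, hM⟩ := hcont μ hμ
    exact ⟨M, fun lam hl => (hM lam hl).2⟩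
  · refine tendsto_iff_norm_sub_tendsto_zero.2 (squeeze_zero' (.of_forall fun _ => norm_nonneg _)
      ?_ hz)
    filter_upwards [eventually_gt_atTop 0] with lam hl using (hlim lam hl).1
  · refine tendsto_iff_norm_sub_tendsto_zero.2 (squeeze_zero' (.of_forall fun _ => norm_nonneg _)
      ?_ hz)
    filter_upwards [eventually_gt_atTop 0] with lam hl using (hlim lam hl).2

open Filter Topology in
theorem isHalfPeriodData (hU : IsOstrovskyWave U γ) {C C' S S' : ℝ → ℝ → ℝ}
    (h : ∀ lam, 0 ≤ lam →
      IsFundPair (fun z => (γ + lam - U z)⁻¹) (C lam) (C' lam) (S lam) (S' lam)) :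
    IsHalfPeriodData (fun lam => C lam π) (fun lam => C' lam π) (fun lam => S lam π)
      (fun lam => S' lam π) := by
  have hq : ∀ {x y : ℝ}, 0 ≤ x → x < y → ∀ z, (γ + y - U z)⁻¹ < (γ + x - U z)⁻¹ :=
    fun hx hxy => hU.inv_lt_inv_param hx hxy
  have h0 := h 0 le_rfl
  simp only [add_zero] at h0
  have hS0 := hU.s_pos h0
  have hS : ∀ lam, 0 < lam → ∀ z ∈ Set.Ioc 0 π, 0 < S lam z := fun lam hl =>
    (h 0 le_rfl).s_pos_of_lt (h lam hl.le) (hq le_rfl hl) hS0.2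
  have hSπ : ∀ lam, 0 < lam → 0 < S lam π := fun lam hl => hS lam hl π ⟨pi_pos, le_rfl⟩
  obtain ⟨hC₁, hC₂, hC₃, -⟩ := hU.continuousOn_and_tendsto pi_pos.le fun lam hl =>
    ⟨(h lam hl).solc, (h lam hl).c_zero, (h lam hl).c'_zero⟩
  obtain ⟨-, hS₂, -, hS₄⟩ := hU.continuousOn_and_tendsto pi_pos.le fun lam hl =>
    ⟨(h lam hl).sols, (h lam hl).s_zero, (h lam hl).s'_zero⟩
  simp only [zero_mul, add_zero] at hC₃
  exact
    { continuousOn_c := hC₁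
      continuousOn_c' := hC₂
      continuousOn_s' := hS₂
      det := fun x hx => (h x hx).det π
      s_pos := hSπ
      c_zero_neg := hU.c_neg h0
      s'_zero_neg := hS0.1
      c'_zero_pos := by
        have := hU.c'_mul_s'_neg h0 pi_pos hU.deriv_pi hS0.1.ne
        exact (pos_iff_neg_of_mul_neg this).2 hS0.1
      c_top := hC₃
      s'_top := hS₄
      c'_top := by
        filter_upwards [eventually_gt_atTop 0, hC₃.eventually (lt_mem_nhds one_pos)] with x hx hcx
        exact (h x hx.le).c'_neg_of_c_nonneg (hU.potential_pos hx.le) (hS x hx) pi_pos hcx.le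
      c_up := fun x y hx hxy hc =>
        (h x hx.le).c_pos_of_lt (h y (hx.trans hxy).le) (hq hx.le hxy) (hS x hx) hc π
          ⟨pi_pos, le_rfl⟩
      c'_down := fun x y hx hxy hc =>
        (h x hx.le).c'_neg_of_lt (h y (hx.trans hxy).le) (hq hx.le hxy)
          (hU.potential_pos (hx.trans hxy).le) pi_pos (hS x hx) (hS y (hx.trans hxy)) hc
      s_wronskian := fun x y hx hxy =>
        (h x hx.le).s_wronskian_neg (h y (hx.trans hxy).le) (hq hx.le hxy) pi_pos (hS x hx)
          (hS y (hx.trans hxy))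
      c_wronskian := fun x y hx hxy hc => hc.elim
        (fun hc => (h x hx.le).c_wronskian_neg_of_neg (h y (hx.trans hxy).le) (hq hx.le hxy)
          pi_pos (hS x hx) (hS y (hx.trans hxy)) hc)
        fun hc => (h x hx.le).c_wronskian_neg_of_nonneg (h y (hx.trans hxy).le) (hq hx.le hxy)
          pi_pos (hS x hx) hc }

/-- The positive eigenvalues of the Hessian operator, counted with multiplicity. -/
theorem sum_finrank_EigSetL (hU : IsOstrovskyWave U γ) {N : ℕ} (hN : 1 ≤ N) :
    ∃ hfin : {lam : ℝ | 0 < lam ∧ ∃ v ∈ EigSetL U γ lam N, v ≠ 0}.Finite,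
      ∑ lam ∈ hfin.toFinset, Module.finrank ℝ (Submodule.span ℝ (EigSetL U γ lam N)) =
        2 * N - 1 := by
  have hex : ∀ lam : ℝ, ∃ c c' s s', 0 ≤ lam →
      IsFundPair (fun z => (γ + lam - U z)⁻¹) c c' s s' := by
    intro lam
    by_cases hl : 0 ≤ lam
    · obtain ⟨c, c', s, s', h⟩ := hU.exists_isFundPair hl
      exact ⟨c, c', s, s', fun _ => h⟩
    · exact ⟨0, 0, 0, 0, fun hl' => absurd hl' hl⟩
  choose C C' S S' h using hex
  have hdata := hU.isHalfPeriodData h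
  have hdim := fun lam (hl : 0 < lam) => finrank_EigSetL N hN hU.contDiff hU.even hU.periodic
    (fun z => by linarith [hU.sub_pos z]) (h lam hl.le) (hdata.s_pos lam hl)
  have hset : {lam : ℝ | 0 < lam ∧ ∃ v ∈ EigSetL U γ lam N, v ≠ 0} =
      {lam | 0 < lam ∧ Module.finrank ℝ (Submodule.span ℝ (EigSetL U γ lam N)) ≠ 0} :=
    Set.ext fun lam => and_congr_right fun hl => (hdim lam hl).1.symm
  simp only [hset]
  exact hdata.sum_multiplicity hN (fun x hx => (hdim x hx).2.1) (fun x hx => (hdim x hx).2.2.1)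
    fun x hx => (hdim x hx).2.2.2

end IsOstrovskyWave

theorem spectrum_L_reduced_ostrovsky :
    ∃ ε > (0:ℝ), ∀ N : ℕ, 1 ≤ N → ∀ γ ∈ Set.Ioo (1:ℝ) (1 + ε), ∀ U : ℝ → ℝ,
      (∀ z : ℝ, U (-z) = U z) → ContDiff ℝ (⊤ : ℕ∞) U → (∃ z w : ℝ, U z ≠ U w) →
      Function.Periodic U (2 * π) →
      (∀ z : ℝ, deriv (fun w => (γ - U w) * deriv U w) z + U z = 0) →
      (∀ z : ℝ, |U z| ≤ ε) →
      (∃ hfin : Set.Finite {lam : ℝ | 0 < lam ∧ ∃ v ∈ EigSetL U γ lam N, v ≠ 0},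
        (∑ lam ∈ hfin.toFinset,
          Module.finrank ℝ (Submodule.span ℝ (EigSetL U γ lam N))) = 2 * N - 1) ∧
      (EigSetL U γ 0 N = {v | ∃ c : ℝ, v = fun z => c * deriv U z} ∧ deriv U ≠ 0) := by
  refine ⟨1 / 2, by norm_num, fun N hN γ hγ U heven hsmooth hne hper hode hε => ?_⟩
  have hU : IsOstrovskyWave U γ := ⟨heven, hsmooth, hne, hper, hode, by linarith [hγ.1],
    fun z => by linarith [hγ.1, le_of_abs_le (hε z)]⟩
  exact ⟨hU.sum_finrank_EigSetL hN, hU.EigSetL_zero hN, hU.deriv_ne_zero⟩
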